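/- arXiv:2007.10132 — 11 statements merged into one kernel-verified Lean document; each statement's English description precedes it below -/
import Mathlib

section
/- Let R be a commutative ring with unity, let k ∈ ℕ, and let I_1, I_2, …, I_{2k} be mutually co-maximal ideals of R (I_i + I_j = R for all i ≠ j). Let I = I_1·I_2⋯I_{2k} and suppose that either I satisfies the USC or I = R. Let Γ ⊆ SP_{2k}(R) be a subgroup such that Γ·Γ_k(I) = SP_{2k}(R). Let M = [m_{i,j}]_{1 ≤ i,j ≤ 2k} be a 2k×2k matrix over R each of whose rows is unital, i.e., ⟨m_{i,1}⟩ + ⟨m_{i,2}⟩ + ⋯ + ⟨m_{i,2k}⟩ = R for every 1 ≤ i ≤ 2k. Then there exists N = [n_{i,j}]_{1 ≤ i,j ≤ 2k} ∈ Γ such that m_{i,j} ≡ n_{i,j} mod I_i for all 1 ≤ i, j ≤ 2k. -/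
open Matrix

/-- An ideal `I` satisfies the unital set condition (USC): for every unital tuple
`a₁, …, aₖ` with `k ≥ 2` (possibly with repetitions) generating the unit ideal, there is
`b ∈ ⟨a₂, …, aₖ⟩` such that `a₁ + b` is a unit modulo `I`. -/
def SatisfiesUSC {R : Type*} [CommRing R] (I : Ideal R) : Prop :=
  ∀ (k : ℕ) (a : Fin (k + 2) → R), Ideal.span (Set.range a) = ⊤ →
    ∃ b ∈ Ideal.span (Set.range fun i : Fin (k + 1) => a i.succ),
      IsUnit (Ideal.Quotient.mk I (a 0 + b))

lemma J_map {l : Type*} [DecidableEq l] [Fintype l] {R S : Type*} [CommRing R] [CommRing S]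
    (f : R →+* S) : (Matrix.J l R).map f = Matrix.J l S := by
  ext i j
  cases i <;> cases j <;>
    simp [Matrix.J, Matrix.fromBlocks, Matrix.map_apply, Matrix.one_apply, apply_ite f]

/-- The reduction homomorphism on symplectic groups induced by a ring homomorphism. -/
def SpMap {l : Type*} [DecidableEq l] [Fintype l] {R S : Type*} [CommRing R] [CommRing S]
    (f : R →+* S) : Matrix.symplecticGroup l R →* Matrix.symplecticGroup l S where
  toFun A := ⟨A.1.map f, by
    have h := A.2
    rw [SymplecticGroup.mem_iff] at h ⊢
    rw [← J_map f, ← Matrix.transpose_map, ← Matrix.map_mul, ← Matrix.map_mul, h]⟩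
  map_one' := Subtype.ext (Matrix.map_one f f.map_zero f.map_one)
  map_mul' A B := Subtype.ext (Matrix.map_mul)

/-- The principal congruence ideal subgroup `Γ(J)` of `SP_{2k}(R)`, the kernel of the
reduction homomorphism `SP_{2k}(R) → SP_{2k}(R/J)`. -/
def SpGamma {R : Type*} [CommRing R] (k : ℕ) (J : Ideal R) :
    Subgroup (Matrix.symplecticGroup (Fin k) R) :=
  (SpMap (Ideal.Quotient.mk J)).ker


lemma usc_vec {R : Type*} [CommRing R] {I : Ideal R} (hI : SatisfiesUSC I)
    {n : Type*} [Fintype n] [DecidableEq n] (m : ℕ) (hn : Fintype.card n = m + 2)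
    (v : n → R) (hv : Ideal.span (Set.range v) = ⊤) (i : n) :
    ∃ w : n → R, w i = 1 ∧ IsUnit (Ideal.Quotient.mk I (v ⬝ᵥ w)) := by
  classical
  let e0 : n ≃ Fin (m + 2) := Fintype.equivFinOfCardEq hn
  let e : n ≃ Fin (m + 2) := e0.trans (Equiv.swap (e0 i) 0)
  have hei : e i = 0 := by simp [e]
  have hr : Set.range (v ∘ e.symm) = Set.range v := by simp
  obtain ⟨b, hb, hu⟩ := hI m (v ∘ e.symm) (by rw [hr, hv])
  obtain ⟨c, hc⟩ := Ideal.mem_span_range_iff_exists_fun.1 hb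
  refine ⟨fun j => (Fin.cons 1 c : Fin (m + 2) → R) (e j), ?_, ?_⟩
  · simp [hei]
  · have : v ⬝ᵥ (fun j => (Fin.cons 1 c : Fin (m + 2) → R) (e j)) = (v ∘ e.symm) 0 + b := by
      rw [dotProduct, ← Equiv.sum_comp e.symm, Fin.sum_univ_succ, ← hc]
      simp [mul_comm]
    rw [this]
    exact hu

section transv
variable {l R : Type*} [DecidableEq l] [Fintype l] [CommRing R]

lemma J_alt (u : l ⊕ l → R) : u ⬝ᵥ (J l R *ᵥ u) = 0 := by
  have : J l R *ᵥ u = Sum.elim (fun a => - u (Sum.inr a)) (fun a => u (Sum.inl a)) := by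
    rw [J, fromBlocks_mulVec]
    ext (a | a) <;> simp [neg_mulVec]
  rw [this]
  simp [dotProduct, mul_comm]

lemma J_skew (u v : l ⊕ l → R) : u ⬝ᵥ (J l R *ᵥ v) = - (v ⬝ᵥ (J l R *ᵥ u)) := by
  have h := J_alt (u + v)
  simp only [mulVec_add, dotProduct_add, add_dotProduct, J_alt] at h
  linear_combination h

lemma transv_mem (u : l ⊕ l → R) (c : R) :
    1 + c • vecMulVec (J l R *ᵥ u) u ∈ symplecticGroup l R := by
  rw [SymplecticGroup.mem_iff]
  have h1 : vecMulVec (J l R *ᵥ u) u * J l R = - vecMulVec (J l R *ᵥ u) (J l R *ᵥ u) := by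
    rw [vecMulVec_mul, ← mulVec_transpose, J_transpose, neg_mulVec, vecMulVec_neg]
  have h2 : J l R * vecMulVec u (J l R *ᵥ u) = vecMulVec (J l R *ᵥ u) (J l R *ᵥ u) := by
    rw [mul_vecMulVec]
  have h3 : vecMulVec (J l R *ᵥ u) (J l R *ᵥ u) * vecMulVec u (J l R *ᵥ u) = 0 := by
    rw [vecMulVec_mul_vecMulVec, dotProduct_comm, J_alt]
    simp
  simp only [transpose_add, transpose_one, transpose_smul, transpose_vecMulVec, add_mul, mul_add,
    Matrix.one_mul, Matrix.mul_one, smul_mul_assoc, mul_smul_comm, h1, h2, neg_mul, h3]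
  simp

/-- symplectic transvection -/
def transv (u : l ⊕ l → R) (c : R) : symplecticGroup l R :=
  ⟨1 + c • vecMulVec (J l R *ᵥ u) u, transv_mem u c⟩

lemma vecMul_transv (v u : l ⊕ l → R) (c : R) :
    v ᵥ* (transv u c).1 = v + (c * (v ⬝ᵥ (J l R *ᵥ u))) • u := by
  simp [transv, vecMul_add, vecMul_smul, vecMul_vecMulVec, smul_smul]

lemma SpMap_transv {S : Type*} [CommRing S] (f : R →+* S) (u : l ⊕ l → R) (c : R)
    (hc : f c = 0) : SpMap f (transv u c) = 1 := by
  apply Subtype.ext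
  ext i j
  simp [SpMap, transv, hc, Matrix.one_apply, apply_ite f]

lemma move (A : Ideal R) (u v : l ⊕ l → R) (c : R)
    (h : c * (u ⬝ᵥ (J l R *ᵥ v)) - 1 ∈ A) (j : l ⊕ l) :
    v j - (u ᵥ* (transv (v - u) c).1) j ∈ A := by
  rw [vecMul_transv, mulVec_sub, dotProduct_sub, J_alt]
  have : v j - (u + (c * (u ⬝ᵥ (J l R *ᵥ v) - 0)) • (v - u)) j =
      -(v j - u j) * (c * (u ⬝ᵥ (J l R *ᵥ v)) - 1) := by
    simp; ring
  rw [this]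
  exact A.mul_mem_left _ h

lemma one_row (A : Ideal R) (e t : R) (he : e - 1 ∈ A) (i : l ⊕ l) (v w : l ⊕ l → R)
    (hw : w i = 1) (ht : t * (v ⬝ᵥ w) - 1 ∈ A) :
    ∃ G : symplecticGroup l R, (∀ j, v j - G.1 i j ∈ A) ∧
      ∀ B : Ideal R, e ∈ B → SpMap (Ideal.Quotient.mk B) G = 1 := by
  set u : l ⊕ l → R := - (J l R *ᵥ w) with hu
  have hJu : J l R *ᵥ u = w := by
    rw [hu, mulVec_neg, mulVec_mulVec, J_squared]; simp [neg_mulVec]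
  set x : l ⊕ l → R := Pi.single i 1 with hx
  refine ⟨transv (u - x) e * transv (v - u) (-(e * t)), ?_, ?_⟩
  · have h1 := move A x u e (by rw [hJu, hx]; simpa [hw] using he)
    have h2 := move A u v (-(e * t)) (by
      rw [J_skew, hJu]
      have : -(e * t) * -(v ⬝ᵥ w) - 1 = e * (t * (v ⬝ᵥ w) - 1) + (e - 1) := by ring
      rw [this]
      exact A.add_mem (A.mul_mem_left _ ht) he)
    intro j
    have h3 : (transv (u - x) e * transv (v - u) (-(e * t))).1 i j =
        ((x ᵥ* (transv (u - x) e).1) ᵥ* (transv (v - u) (-(e * t))).1) j := by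
      rw [vecMul_vecMul, hx, single_one_vecMul]
      rfl
    have h4 : (u ᵥ* (transv (v - u) (-(e * t))).1) j -
        ((x ᵥ* (transv (u - x) e).1) ᵥ* (transv (v - u) (-(e * t))).1) j ∈ A := by
      rw [← Pi.sub_apply, ← sub_vecMul]
      exact A.sum_mem fun a _ => A.mul_mem_right _ (h1 a)
    rw [h3]
    simpa using A.add_mem (h2 j) h4
  · intro B hB
    have h0 : Ideal.Quotient.mk B e = 0 := Ideal.Quotient.eq_zero_iff_mem.2 hB
    rw [map_mul, SpMap_transv _ _ _ h0, SpMap_transv _ _ _ (by simp [h0]), one_mul]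

end transv

theorem stmt2 {R : Type*} [CommRing R] (k : ℕ) (I : Fin k ⊕ Fin k → Ideal R)
    (hco : ∀ i j, i ≠ j → I i ⊔ I j = ⊤)
    (hI : SatisfiesUSC (∏ i, I i) ∨ (∏ i, I i) = ⊤)
    (Γ : Subgroup (Matrix.symplecticGroup (Fin k) R))
    (hΓ : ∀ g : Matrix.symplecticGroup (Fin k) R,
      ∃ a ∈ Γ, ∃ b ∈ SpGamma k (∏ i, I i), g = a * b)
    (M : Matrix (Fin k ⊕ Fin k) (Fin k ⊕ Fin k) R)
    (hM : ∀ i, Ideal.span (Set.range (M i)) = ⊤) :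
    ∃ N ∈ Γ, ∀ i j, M i j - (N : Matrix.symplecticGroup (Fin k) R).1 i j ∈ I i := by
  classical
  have hle : ∀ i, (∏ i, I i) ≤ I i := fun i =>
    Ideal.prod_le_inf.trans (Finset.inf_le (Finset.mem_univ i))
  rcases hI with hI | hI
  swap
  · refine ⟨1, Γ.one_mem, fun i j => hle i ?_⟩
    rw [hI]; trivial
  have key : ∀ i, ∃ G : symplecticGroup (Fin k) R, (∀ j, M i j - G.1 i j ∈ I i) ∧
      ∀ j, j ≠ i → SpMap (Ideal.Quotient.mk (I j)) G = 1 := by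
    intro i
    have hk : 0 < k := by rcases i with i | i <;> exact i.pos
    obtain ⟨w, hw, hu⟩ := usc_vec hI (2 * k - 2) (by simp; omega) (M i) (hM i) i
    obtain ⟨t', ht'⟩ := hu.exists_left_inv
    obtain ⟨t, rfl⟩ := Ideal.Quotient.mk_surjective t'
    rw [← map_mul, ← map_one (Ideal.Quotient.mk _), Ideal.Quotient.eq] at ht'
    obtain ⟨e, he⟩ := Ideal.exists_forall_sub_mem_ideal (I := I)
      (fun a b hab => Ideal.isCoprime_iff_sup_eq.2 (hco a b hab)) (Pi.single i 1)
    obtain ⟨G, h1, h2⟩ := one_row (I i) e t (by simpa using he i) i (M i) w hw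
      (hle i ht')
    exact ⟨G, h1, fun j hj => h2 _ (by simpa [hj] using he j)⟩
  choose G hG1 hG2 using key
  have ind : ∀ s : Finset (Fin k ⊕ Fin k), ∃ N : symplecticGroup (Fin k) R,
      (∀ i ∈ s, SpMap (Ideal.Quotient.mk (I i)) N = SpMap (Ideal.Quotient.mk (I i)) (G i)) ∧
      ∀ i ∉ s, SpMap (Ideal.Quotient.mk (I i)) N = 1 := by
    intro s
    induction s using Finset.induction_on with
    | empty => exact ⟨1, by simp, by simp⟩
    | insert a s ha ih =>
      obtain ⟨N, h1, h2⟩ := ih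
      refine ⟨G a * N, fun i hi => ?_, fun i hi => ?_⟩
      · by_cases hia : i = a
        · subst hia
          rw [map_mul, h2 i ha, mul_one]
        · rw [map_mul, hG2 a i hia, one_mul]
          exact h1 i ((Finset.mem_insert.1 hi).resolve_left hia)
      · rw [Finset.mem_insert, not_or] at hi
        rw [map_mul, hG2 a i hi.1, one_mul, h2 i hi.2]
  obtain ⟨N, hN, -⟩ := ind Finset.univ
  obtain ⟨a, ha, b, hb, hab⟩ := hΓ N
  refine ⟨a, ha, fun i j => ?_⟩
  have hb1 : SpMap (Ideal.Quotient.mk (I i)) b = 1 := by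
    have hb' : SpMap (Ideal.Quotient.mk (∏ i, I i)) b = 1 := hb
    apply Subtype.ext
    ext p q
    have h := congrFun (congrFun (congrArg Subtype.val hb') p) q
    have h' : Ideal.Quotient.mk (∏ i, I i) (b.1 p q) =
        Ideal.Quotient.mk (∏ i, I i) ((1 : Matrix _ _ R) p q) := by
      refine h.trans ?_
      simp [Matrix.one_apply, apply_ite (Ideal.Quotient.mk (∏ i, I i))]
    have h'' := Ideal.Quotient.eq.2 (hle i (Ideal.Quotient.eq.1 h'))
    refine h''.trans ?_
    simp [Matrix.one_apply, apply_ite (Ideal.Quotient.mk (I i))]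
  have h1 := hN i (Finset.mem_univ i)
  rw [hab, map_mul, hb1, mul_one] at h1
  have h2 : Ideal.Quotient.mk (I i) (a.1 i j) = Ideal.Quotient.mk (I i) ((G i).1 i j) :=
    congrFun (congrFun (congrArg Subtype.val h1) i) j
  rw [← Ideal.Quotient.eq, h2, Ideal.Quotient.eq]
  exact hG1 i j
end

section
/- Let R be a commutative ring with unity, let k ∈ ℕ, and let I_1, I_2, …, I_{2k} be mutually co-maximal ideals of R (I_i + I_j = R for all i ≠ j) such that for I = I_1·I_2⋯I_{2k} either I satisfies the USC or I = R. Let m_j^i be positive integers for 1 ≤ i, j ≤ 2k, and let Γ ⊆ SP_{2k}(R) be a subgroup such that Γ·Γ_k(I) = SP_{2k}(R). Then the map from Γ to the product PF^{2k−1,(m_1^1,…,m_{2k}^1)}_{I_1} × PF^{2k−1,(m_1^2,…,m_{2k}^2)}_{I_2} × ⋯ × PF^{2k−1,(m_1^{2k},…,m_{2k}^{2k})}_{I_{2k}}, sending a matrix A = [a_{i,j}]_{1 ≤ i,j ≤ 2k} ∈ Γ to the tuple whose i-th component is the class [a_{i,1} : a_{i,2} : ⋯ : a_{i,2k}] of its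 i-th row, is surjective. -/
open Matrix

/-- Each row of a symplectic matrix is unital. -/
lemma Sp_row_unital {l : Type*} [DecidableEq l] [Fintype l] {R : Type*} [CommRing R]
    (A : Matrix.symplecticGroup l R) (i : l ⊕ l) :
    Ideal.span (Set.range fun j => A.1 i j) = ⊤ := by
  rw [Ideal.eq_top_iff_one]
  have h : (A.1 * (A⁻¹).1) i i = 1 := by
    rw [← Submonoid.coe_mul, mul_inv_cancel]
    simp
  rw [Matrix.mul_apply] at h
  have hmem : ∑ j, A.1 i j * (A⁻¹).1 j i ∈ Ideal.span (Set.range fun j => A.1 i j) :=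
    Ideal.sum_mem _ fun j _ => Ideal.mul_mem_right _ _ (Ideal.subset_span ⟨j, rfl⟩)
  rwa [h] at hmem

/-- The set `GCD(R)` of unital tuples indexed by `ι`. -/
def GCDTuple (R : Type*) [CommRing R] (ι : Type*) : Type _ :=
  {a : ι → R // Ideal.span (Set.range a) = ⊤}

/-- The equivalence relation defining the generalized projective space `PF^{ι,m}_I`:
two unital tuples are related iff there is `λ ∈ R`, a unit modulo `I`, with
`aᵢ ≡ λ^{mᵢ}·bᵢ mod I` for all `i`.  (When `I = R` this is the trivial relation in which
any two tuples are related, so the quotient is a singleton.) -/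
def PFRel {R : Type*} [CommRing R] {ι : Type*} (I : Ideal R) (m : ι → ℕ)
    (a b : GCDTuple R ι) : Prop :=
  ∃ lam : R, IsUnit (Ideal.Quotient.mk I lam) ∧ ∀ i, a.1 i - lam ^ m i * b.1 i ∈ I

/-- The generalized projective space `PF^{ι,m}_I` associated to the ideal `I`. -/
def PF (R : Type*) [CommRing R] (ι : Type*) (I : Ideal R) (m : ι → ℕ) : Type _ :=
  Quot (PFRel I m)

lemma aux_J_vecMul {l : Type*} [DecidableEq l] [Fintype l] {R : Type*} [CommRing R]
    (u : l ⊕ l → R) : u ᵥ* Matrix.J l R = -(Matrix.J l R *ᵥ u) := by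
  rw [← Matrix.mulVec_transpose, Matrix.J_transpose, Matrix.neg_mulVec]

lemma aux_alt {l : Type*} [DecidableEq l] [Fintype l] {R : Type*} [CommRing R]
    (u : l ⊕ l → R) : u ⬝ᵥ (Matrix.J l R *ᵥ u) = 0 := by
  have h : Matrix.J l R *ᵥ u = Sum.elim (-(u ∘ Sum.inr)) (u ∘ Sum.inl) := by
    rw [Matrix.J, Matrix.fromBlocks_mulVec]
    simp [Matrix.neg_mulVec]
  rw [h]
  simp [dotProduct, Fintype.sum_sum_type, mul_comm]

/-- Symplectic transvections. -/
lemma aux_transv {l : Type*} [DecidableEq l] [Fintype l] {R : Type*} [CommRing R]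
    (u : l ⊕ l → R) (t : R) :
    (1 + t • Matrix.vecMulVec (Matrix.J l R *ᵥ u) u) ∈ Matrix.symplecticGroup l R := by
  rw [SymplecticGroup.mem_iff]
  have h1 : Matrix.vecMulVec (Matrix.J l R *ᵥ u) u * Matrix.J l R
      = - Matrix.vecMulVec (Matrix.J l R *ᵥ u) (Matrix.J l R *ᵥ u) := by
    rw [Matrix.vecMulVec_mul, aux_J_vecMul, Matrix.vecMulVec_neg]
  have h2 : Matrix.J l R * Matrix.vecMulVec u (Matrix.J l R *ᵥ u)
      = Matrix.vecMulVec (Matrix.J l R *ᵥ u) (Matrix.J l R *ᵥ u) := by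
    rw [Matrix.mul_vecMulVec]
  have h3 : Matrix.vecMulVec (Matrix.J l R *ᵥ u) (Matrix.J l R *ᵥ u) *
      Matrix.vecMulVec u (Matrix.J l R *ᵥ u) = 0 := by
    rw [Matrix.vecMulVec_mul_vecMulVec, dotProduct_comm, aux_alt]
    simp
  rw [Matrix.transpose_add, Matrix.transpose_one, Matrix.transpose_smul,
    Matrix.transpose_vecMulVec, add_mul, one_mul, smul_mul_assoc, h1, mul_add, mul_one, add_mul,
    mul_smul_comm, h2, smul_mul_assoc, mul_smul_comm, neg_mul, h3]
  simp

lemma aux_step {k : ℕ} {R : Type*} [CommRing R] (P Q : Ideal R) (hPQ : Q ⊔ P = ⊤)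
    (v w : Fin k ⊕ Fin k → R)
    (h : IsUnit (Ideal.Quotient.mk Q (v ⬝ᵥ (Matrix.J (Fin k) R *ᵥ w)))) :
    ∃ A ∈ SpGamma k P, (Ideal.Quotient.mk Q ∘ v) ᵥ* (A.1.map (Ideal.Quotient.mk Q))
      = Ideal.Quotient.mk Q ∘ w := by
  obtain ⟨q, hq, e, he, hqe⟩ := Submodule.mem_sup.1 ((Ideal.eq_top_iff_one _).1 hPQ)
  obtain ⟨a', ha'⟩ := h.exists_right_inv
  obtain ⟨a, rfl⟩ := Ideal.Quotient.mk_surjective a'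
  have he1 : Ideal.Quotient.mk Q e = 1 := by
    rw [← map_one (Ideal.Quotient.mk Q), ← hqe, map_add, Ideal.Quotient.eq_zero_iff_mem.2 hq,
      zero_add]
  refine ⟨⟨_, aux_transv (w - v) (a * e)⟩, ?_, ?_⟩
  · rw [SpGamma, MonoidHom.mem_ker]
    apply Subtype.ext
    ext i j
    by_cases hij : i = j <;>
      simp [SpMap, Matrix.one_apply, hij, Ideal.Quotient.eq_zero_iff_mem.2 he]
  · have : v ᵥ* (1 + (a * e) • Matrix.vecMulVec (Matrix.J (Fin k) R *ᵥ (w - v)) (w - v))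
        = v + (a * e * (v ⬝ᵥ (Matrix.J (Fin k) R *ᵥ w))) • (w - v) := by
      rw [Matrix.vecMul_add, Matrix.vecMul_one, Matrix.vecMul_smul, Matrix.vecMul_vecMulVec,
        Matrix.mulVec_sub, dotProduct_sub, aux_alt, sub_zero, smul_smul]
    ext j
    rw [← RingHom.map_vecMul, this]
    have h2 : Ideal.Quotient.mk Q (a * e * (v ⬝ᵥ (Matrix.J (Fin k) R *ᵥ w))) = 1 := by
      rw [map_mul, map_mul, he1, mul_one, mul_comm, ha']
    rw [Pi.add_apply, Pi.smul_apply, smul_eq_mul, map_add, map_mul, h2]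
    simp

lemma aux_usc {k : ℕ} {R : Type*} [CommRing R] (I : Ideal R) (hI : SatisfiesUSC I ∨ I = ⊤)
    (i : Fin k ⊕ Fin k) (v : Fin k ⊕ Fin k → R) (hv : Ideal.span (Set.range v) = ⊤) :
    ∃ c : Fin k ⊕ Fin k → R, c i = 1 ∧ IsUnit (Ideal.Quotient.mk I (v ⬝ᵥ c)) := by
  rcases hI with hI | rfl
  · obtain ⟨n, rfl⟩ : ∃ n, k = n + 1 := by
      rcases k with _ | n
      · rcases i with i | i <;> exact i.elim0
      · exact ⟨n, rfl⟩
    have hc : Fintype.card (Fin (2 * n + 2)) = Fintype.card (Fin (n + 1) ⊕ Fin (n + 1)) := by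
      simp; ring
    let e0 := Fintype.equivOfCardEq hc
    let e := (Equiv.swap 0 (e0.symm i)).trans e0
    have he : e 0 = i := by simp [e]
    obtain ⟨b, hb, hu⟩ := hI (2 * n) (v ∘ e) (by rw [e.surjective.range_comp, hv])
    obtain ⟨c, rfl⟩ := Submodule.mem_span_range_iff_exists_fun R |>.1 hb
    refine ⟨(Fin.cons 1 c : Fin (2 * n + 2) → R) ∘ e.symm, ?_, ?_⟩
    · simp [← he]
    · convert hu using 2
      rw [dotProduct, ← e.sum_comp, Fin.sum_univ_succ]
      simp [mul_comm]
  · exact ⟨fun _ => 1, rfl, by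
      have := Ideal.Quotient.subsingleton_iff.2 (rfl : (⊤ : Ideal R) = ⊤)
      exact isUnit_of_subsingleton _⟩

lemma aux_row {k : ℕ} {R : Type*} [CommRing R] (P Q I : Ideal R) (hPQ : Q ⊔ P = ⊤)
    (hIQ : I ≤ Q) (hI : SatisfiesUSC I ∨ I = ⊤)
    (i : Fin k ⊕ Fin k) (v : Fin k ⊕ Fin k → R) (hv : Ideal.span (Set.range v) = ⊤) :
    ∃ A ∈ SpGamma k P, ∀ j, Ideal.Quotient.mk Q (A.1 i j) = Ideal.Quotient.mk Q (v j) := by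
  obtain ⟨c, hci, hc⟩ := aux_usc I hI i v hv
  have hcQ : IsUnit (Ideal.Quotient.mk Q (v ⬝ᵥ c)) := by
    have := hc.map (Ideal.Quotient.factor hIQ)
    rwa [Ideal.Quotient.factor_mk] at this
  have hJu : Matrix.J (Fin k) R *ᵥ (-(Matrix.J (Fin k) R *ᵥ c)) = c := by
    rw [Matrix.mulVec_neg, Matrix.mulVec_mulVec, Matrix.J_squared, Matrix.neg_mulVec,
      Matrix.one_mulVec, neg_neg]
  generalize -(Matrix.J (Fin k) R *ᵥ c) = u at hJu
  obtain ⟨A, hA, hA'⟩ := aux_step P Q hPQ (Pi.single i 1) u (by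
    rw [hJu, single_one_dotProduct, hci, map_one]; exact isUnit_one)
  obtain ⟨B, hB, hB'⟩ := aux_step P Q hPQ u v (by
    rw [Matrix.dotProduct_mulVec, aux_J_vecMul, hJu, neg_dotProduct, dotProduct_comm, map_neg]
    exact hcQ.neg)
  refine ⟨A * B, mul_mem hA hB, fun j => ?_⟩
  have h := congrFun hB' j
  rw [← hA', Matrix.vecMul_vecMul, ← Matrix.map_mul, ← RingHom.map_vecMul,
    Matrix.single_one_vecMul] at h
  exact h

theorem stmt5 {R : Type*} [CommRing R] (k : ℕ) (I : Fin k ⊕ Fin k → Ideal R)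
    (hco : ∀ i j, i ≠ j → I i ⊔ I j = ⊤)
    (hI : SatisfiesUSC (∏ i, I i) ∨ (∏ i, I i) = ⊤)
    (m : Fin k ⊕ Fin k → Fin k ⊕ Fin k → ℕ) (hm : ∀ i j, 0 < m i j)
    (Γ : Subgroup (Matrix.symplecticGroup (Fin k) R))
    (hΓ : ∀ g : Matrix.symplecticGroup (Fin k) R,
      ∃ a ∈ Γ, ∃ b ∈ SpGamma k (∏ i, I i), g = a * b) :
    Function.Surjective
      (fun (A : Γ) (i : Fin k ⊕ Fin k) =>
        Quot.mk (PFRel (I i) (m i)) ⟨fun j => A.1.1 i j, Sp_row_unital A.1 i⟩ :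
        Γ → ∀ i : Fin k ⊕ Fin k, PF R (Fin k ⊕ Fin k) (I i) (m i)) := by
  intro y
  have hy : ∀ i, ∃ v : GCDTuple R (Fin k ⊕ Fin k), Quot.mk (PFRel (I i) (m i)) v = y i :=
    fun i => Quot.exists_rep (y i)
  choose v hv using hy
  have hle : ∀ i, ∏ j, I j ≤ I i := fun i =>
    Ideal.prod_le_inf.trans (Finset.inf_le (Finset.mem_univ i))
  have hrow : ∀ i, ∃ A : Matrix.symplecticGroup (Fin k) R,
      (∀ j, j ≠ i → SpMap (Ideal.Quotient.mk (I j)) A = 1) ∧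
      ∀ j, Ideal.Quotient.mk (I i) (A.1 i j) = Ideal.Quotient.mk (I i) ((v i).1 j) := by
    intro i
    obtain ⟨A, hA, hA'⟩ := aux_row (⨅ j ∈ Finset.univ.erase i, I j) (I i) _
      (Ideal.sup_iInf_eq_top fun j hj => hco i j (Finset.ne_of_mem_erase hj).symm)
      (hle i) hI i (v i).1 (v i).2
    refine ⟨A, fun j hj => ?_, hA'⟩
    have hPj : (⨅ j ∈ Finset.univ.erase i, I j) ≤ I j :=
      iInf₂_le j (Finset.mem_erase.2 ⟨hj, Finset.mem_univ _⟩)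
    rw [SpGamma, MonoidHom.mem_ker] at hA
    apply Subtype.ext
    ext a b
    have h := congrArg (Ideal.Quotient.factor hPj) (congrFun (congrFun (congrArg Subtype.val hA) a) b)
    simpa [SpMap, Matrix.one_apply, apply_ite] using h
  choose A hA1 hA2 using hrow
  have hprod : ∀ s : Finset (Fin k ⊕ Fin k), ∃ B : Matrix.symplecticGroup (Fin k) R,
      (∀ i ∈ s, SpMap (Ideal.Quotient.mk (I i)) B = SpMap (Ideal.Quotient.mk (I i)) (A i)) ∧
      ∀ i, i ∉ s → SpMap (Ideal.Quotient.mk (I i)) B = 1 := by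
    intro s
    induction s using Finset.induction_on with
    | empty => exact ⟨1, by simp, by simp⟩
    | insert a s ha ih =>
      obtain ⟨B, hB1, hB2⟩ := ih
      refine ⟨A a * B, fun i hi => ?_, fun i hi => ?_⟩
      · rcases Finset.mem_insert.1 hi with rfl | hi
        · rw [map_mul, hB2 _ ha, mul_one]
        · rw [map_mul, hB1 i hi, hA1 a i (fun h => ha (h ▸ hi)), one_mul]
      · rw [Finset.mem_insert, not_or] at hi
        rw [map_mul, hB2 i hi.2, hA1 a i hi.1, one_mul]
  obtain ⟨B, hB, -⟩ := hprod Finset.univ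
  obtain ⟨g, hg, b, hb, hgb⟩ := hΓ B
  refine ⟨⟨g, hg⟩, funext fun i => ?_⟩
  rw [← hv i]
  apply Quot.sound
  refine ⟨1, by simp, fun j => ?_⟩
  have hbi : SpMap (Ideal.Quotient.mk (I i)) b = 1 := by
    rw [SpGamma, MonoidHom.mem_ker] at hb
    apply Subtype.ext
    ext x y
    have h := congrArg (Ideal.Quotient.factor (hle i))
      (congrFun (congrFun (congrArg Subtype.val hb) x) y)
    simpa [SpMap, Matrix.one_apply, apply_ite] using h
  have h1 := hB i (Finset.mem_univ i)
  rw [hgb, map_mul, hbi, mul_one] at h1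
  have h2 : Ideal.Quotient.mk (I i) (g.1 i j) = Ideal.Quotient.mk (I i) ((A i).1 i j) :=
    congrFun (congrFun (congrArg Subtype.val h1) i) j
  rw [hA2] at h2
  rw [one_pow, one_mul]
  exact Ideal.Quotient.eq.1 h2
end

section
/- Let R be a commutative ring with unity, let k ∈ ℕ, and let I, J ⊊ R be two co-maximal ideals (I + J = R) such that the product ideal I·J satisfies the USC. Then Γ_k(I)·Γ_k(J) = SL_{k+1}(R), i.e., every element of SL_{k+1}(R) is a product of an element of Γ_k(I) and an element of Γ_k(J). -/
open Matrix

/-- The principal congruence ideal subgroup `Γ(J)` of `SL_n(R)`, the kernel of the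
reduction homomorphism `SL_n(R) → SL_n(R/J)`. -/
def SLGamma {R : Type*} [CommRing R] (n : ℕ) (J : Ideal R) :
    Subgroup (Matrix.SpecialLinearGroup (Fin n) R) :=
  (Matrix.SpecialLinearGroup.map (Ideal.Quotient.mk J)).ker

section helpers
variable {R S : Type*} [CommRing R] [CommRing S]

/-- a matrix over `S` lifting to a determinant one matrix over `R` -/
def GoodLift {ι : Type*} [Fintype ι] [DecidableEq ι] (f : R →+* S) (M : Matrix ι ι S) : Prop :=
  ∃ N : Matrix ι ι R, N.det = 1 ∧ N.map f = M

theorem GoodLift.mul {ι : Type*} [Fintype ι] [DecidableEq ι] {f : R →+* S} {M N : Matrix ι ι S}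
    (hM : GoodLift f M) (hN : GoodLift f N) : GoodLift f (M * N) := by
  obtain ⟨A, hA, rfl⟩ := hM
  obtain ⟨B, hB, rfl⟩ := hN
  exact ⟨A * B, by rw [det_mul, hA, hB, one_mul], Matrix.map_mul⟩

theorem map_surj {f : R →+* S} (hf : Function.Surjective f) {m n : Type*} (X : Matrix m n S) :
    ∃ Y : Matrix m n R, Y.map f = X := by
  choose g hg using hf
  exact ⟨X.map g, by ext; simp [hg]⟩

theorem goodUpper {m : Type*} [Fintype m] [DecidableEq m] {f : R →+* S}
    (hf : Function.Surjective f) (X : Matrix Unit m S) :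
    GoodLift f (fromBlocks 1 X 0 1) := by
  obtain ⟨Y, rfl⟩ := map_surj hf X
  refine ⟨fromBlocks 1 Y 0 1, by simp, ?_⟩
  rw [fromBlocks_map]; simp

theorem goodLower {m : Type*} [Fintype m] [DecidableEq m] {f : R →+* S}
    (hf : Function.Surjective f) (X : Matrix m Unit S) :
    GoodLift f (fromBlocks 1 0 X 1) := by
  obtain ⟨Y, rfl⟩ := map_surj hf X
  refine ⟨fromBlocks 1 0 Y 1, by simp, ?_⟩
  rw [fromBlocks_map]; simp

theorem upperCancel {m : Type*} [Fintype m] [DecidableEq m] {f : R →+* S}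
    (hf : Function.Surjective f) (X : Matrix Unit m S) (M : Matrix (Unit ⊕ m) (Unit ⊕ m) S)
    (h : GoodLift f (fromBlocks 1 X 0 1 * M)) : GoodLift f M := by
  have := (goodUpper hf (-X)).mul h
  rw [← Matrix.mul_assoc, fromBlocks_multiply] at this
  simpa using this

theorem lowerCancel {m : Type*} [Fintype m] [DecidableEq m] {f : R →+* S}
    (hf : Function.Surjective f) (X : Matrix m Unit S) (M : Matrix (Unit ⊕ m) (Unit ⊕ m) S)
    (h : GoodLift f (fromBlocks 1 0 X 1 * M)) : GoodLift f M := by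
  have := (goodLower hf (-X)).mul h
  rw [← Matrix.mul_assoc, fromBlocks_multiply] at this
  simpa using this

/-- stable range one, in finite form -/
def SROne (S : Type*) [CommRing S] : Prop :=
  ∀ (m : ℕ) (a : S) (c : Fin m → S) (w : S) (v : Fin m → S), w * a + ∑ i, v i * c i = 1 →
    ∃ x : Fin m → S, IsUnit (a + ∑ i, x i * c i)

theorem srOne_of_usc {I : Ideal R} (h : SatisfiesUSC I) : SROne (R ⧸ I) := by
  intro m a c w v hw
  have hs : Function.Surjective (Ideal.Quotient.mk I) := Ideal.Quotient.mk_surjective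
  obtain ⟨a, rfl⟩ := hs a
  obtain ⟨w, rfl⟩ := hs w
  choose g hg using hs
  obtain ⟨c, rfl⟩ : ∃ c' : Fin m → R, (fun i => Ideal.Quotient.mk I (c' i)) = c :=
    ⟨fun i => g (c i), by ext; simp [hg]⟩
  obtain ⟨v, rfl⟩ : ∃ c' : Fin m → R, (fun i => Ideal.Quotient.mk I (c' i)) = v :=
    ⟨fun i => g (v i), by ext; simp [hg]⟩
  set t := 1 - (w * a + ∑ i, v i * c i) with ht
  have htI : Ideal.Quotient.mk I t = 0 := by
    rw [ht]; simp only [map_sub, map_one, map_add, map_mul, map_sum]; rw [hw, sub_self]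
  obtain ⟨b, hb, hu⟩ := h m (Fin.cons a (Fin.cons t c)) (by
    rw [Ideal.eq_top_iff_one, Ideal.mem_span_range_iff_exists_fun]
    refine ⟨Fin.cons w (Fin.cons 1 v), ?_⟩
    simp [Fin.sum_univ_succ, ht]; ring)
  rw [Ideal.mem_span_range_iff_exists_fun] at hb
  obtain ⟨x, rfl⟩ := hb
  refine ⟨fun i => Ideal.Quotient.mk I (x i.succ), ?_⟩
  simpa [Fin.sum_univ_succ, htI] using hu

theorem good_step {f : R →+* S} (hf : Function.Surjective f) (hS : SROne S) (k : ℕ)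
    (ih : ∀ M : Matrix (Fin (k+1)) (Fin (k+1)) S, M.det = 1 → GoodLift f M)
    (M : Matrix (Unit ⊕ Fin (k+1)) (Unit ⊕ Fin (k+1)) S) (hM : M.det = 1) : GoodLift f M := by
  -- corner one
  have h1 : ∀ (B : Matrix Unit (Fin (k+1)) S) (C : Matrix (Fin (k+1)) Unit S)
      (D : Matrix (Fin (k+1)) (Fin (k+1)) S), (fromBlocks 1 B C D).det = 1 →
      GoodLift f (fromBlocks 1 B C D) := by
    intro B C D hd
    rw [det_fromBlocks_one₁₁] at hd
    apply lowerCancel hf (-C)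
    have : fromBlocks 1 0 (-C) 1 * fromBlocks 1 B C D
        = fromBlocks 1 0 0 (D - C * B) * fromBlocks 1 B 0 1 := by
      rw [fromBlocks_multiply, fromBlocks_multiply]
      congr 1 <;> simp
      abel
    rw [this]
    refine GoodLift.mul ?_ (goodUpper hf B)
    obtain ⟨N, hN, hN'⟩ := ih _ hd
    refine ⟨fromBlocks 1 0 0 N, by simp [hN], ?_⟩
    rw [fromBlocks_map, hN']; simp
  have h2 : ∀ (A : Matrix Unit Unit S) (B : Matrix Unit (Fin (k+1)) S)
      (C : Matrix (Fin (k+1)) Unit S)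
      (D : Matrix (Fin (k+1)) (Fin (k+1)) S), C 0 () = 1 → (fromBlocks A B C D).det = 1 →
      GoodLift f (fromBlocks A B C D) := by
    intro A B C D hC hd
    let X : Matrix Unit (Fin (k+1)) S := of fun _ j => if j = 0 then 1 - A () () else 0
    apply upperCancel hf X
    have hdet : (fromBlocks 1 X 0 1 * fromBlocks A B C D).det = 1 := by
      rw [det_mul, hd]; simp
    rw [fromBlocks_multiply] at hdet ⊢
    have hA : (1 * A + X * C : Matrix Unit Unit S) = 1 := by
      ext i j
      simp [Matrix.mul_apply, X, hC]
    rw [hA] at hdet ⊢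
    exact h1 _ _ _ hdet
  have h3 : ∀ (A : Matrix Unit Unit S) (B : Matrix Unit (Fin (k+1)) S)
      (C : Matrix (Fin (k+1)) Unit S)
      (D : Matrix (Fin (k+1)) (Fin (k+1)) S), IsUnit (A () ()) → (fromBlocks A B C D).det = 1 →
      GoodLift f (fromBlocks A B C D) := by
    intro A B C D hA hd
    obtain ⟨v, hv⟩ := hA.exists_left_inv
    let X : Matrix (Fin (k+1)) Unit S := of fun _ _ => (1 - C 0 ()) * v
    apply lowerCancel hf X
    have hdet : (fromBlocks 1 0 X 1 * fromBlocks A B C D).det = 1 := by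
      rw [det_mul, hd]; simp
    rw [fromBlocks_multiply] at hdet ⊢
    refine h2 _ _ _ _ ?_ hdet
    simp [Matrix.mul_apply, X, mul_assoc, hv]
  have hrow : M.adjugate (Sum.inl ()) (Sum.inl ()) * M (Sum.inl ()) (Sum.inl ()) +
      ∑ i, M.adjugate (Sum.inl ()) (Sum.inr i) * M (Sum.inr i) (Sum.inl ()) = 1 := by
    have := congrFun (congrFun (adjugate_mul M) (Sum.inl ())) (Sum.inl ())
    rw [hM, Matrix.mul_apply, Fintype.sum_sum_type] at this
    simpa using this
  obtain ⟨x, hx⟩ := hS _ _ _ _ _ hrow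
  let X : Matrix Unit (Fin (k+1)) S := of fun _ j => x j
  apply upperCancel hf X
  have hdet : (fromBlocks 1 X 0 1 * M).det = 1 := by
    rw [det_mul, hM]; simp
  rw [← fromBlocks_toBlocks M, fromBlocks_multiply] at hdet ⊢
  refine h3 _ _ _ _ ?_ hdet
  simpa [Matrix.mul_apply, X, toBlocks₁₁, toBlocks₂₁] using hx

theorem good_all {f : R →+* S} (hf : Function.Surjective f) (hS : SROne S) (k : ℕ) :
    ∀ M : Matrix (Fin (k+1)) (Fin (k+1)) S, M.det = 1 → GoodLift f M := by
  induction k with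
  | zero =>
    intro M hM
    refine ⟨1, by simp, ?_⟩
    rw [det_fin_one] at hM
    ext i j
    fin_cases i; fin_cases j
    simp [hM]
  | succ k ih =>
    intro M hM
    let e : Fin (k+2) ≃ Unit ⊕ Fin (k+1) := Fintype.equivOfCardEq (by simp; omega)
    obtain ⟨N, hN, hN'⟩ := good_step hf hS k ih (M.submatrix e.symm e.symm)
      (by rw [det_submatrix_equiv_self, hM])
    refine ⟨N.submatrix e e, by rw [det_submatrix_equiv_self, hN], ?_⟩
    rw [← submatrix_map, hN']
    simp

end helpers

theorem stmt7 {R : Type*} [CommRing R] (k : ℕ) (I J : Ideal R)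
    (hI : I ≠ ⊤) (hJ : J ≠ ⊤) (hco : I ⊔ J = ⊤) (hUSC : SatisfiesUSC (I * J)) :
    ∀ g : Matrix.SpecialLinearGroup (Fin (k + 1)) R,
      ∃ a ∈ SLGamma (k + 1) I, ∃ b ∈ SLGamma (k + 1) J, g = a * b := by
  intro g
  have h1 : (1 : R) ∈ I ⊔ J := hco ▸ Submodule.mem_top
  obtain ⟨i, hi, j, hj, hij⟩ := Submodule.mem_sup.1 h1
  let N0 : Matrix (Fin (k+1)) (Fin (k+1)) R := j • g.1 + i • 1
  have hiI : Ideal.Quotient.mk I i = 0 := Ideal.Quotient.eq_zero_iff_mem.2 hi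
  have hjJ : Ideal.Quotient.mk J j = 0 := Ideal.Quotient.eq_zero_iff_mem.2 hj
  have hjI : Ideal.Quotient.mk I j = 1 := by
    have := congrArg (Ideal.Quotient.mk I) hij
    simpa [hiI] using this
  have hiJ : Ideal.Quotient.mk J i = 1 := by
    have := congrArg (Ideal.Quotient.mk J) hij
    simpa [hjJ] using this
  have hNI : N0.map (Ideal.Quotient.mk I) = g.1.map (Ideal.Quotient.mk I) := by
    ext a b; simp [N0, hiI, hjI]
  have hNJ : N0.map (Ideal.Quotient.mk J) = (1 : Matrix _ _ R).map (Ideal.Quotient.mk J) := by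
    ext a b; simp [N0, hiJ, hjJ]
  have hdI : N0.det - 1 ∈ I := by
    rw [← Ideal.Quotient.eq_zero_iff_mem, map_sub, RingHom.map_det, RingHom.mapMatrix_apply, hNI,
      ← RingHom.mapMatrix_apply, ← RingHom.map_det, g.2, sub_self]
  have hdJ : N0.det - 1 ∈ J := by
    rw [← Ideal.Quotient.eq_zero_iff_mem, map_sub, RingHom.map_det, RingHom.mapMatrix_apply, hNJ,
      ← RingHom.mapMatrix_apply, ← RingHom.map_det, det_one, sub_self]
  have hd : N0.det - 1 ∈ I * J := by
    rw [Ideal.mul_eq_inf_of_coprime hco]; exact ⟨hdI, hdJ⟩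
  obtain ⟨N, hN, hN'⟩ := good_all Ideal.Quotient.mk_surjective (srOne_of_usc hUSC) k
    (N0.map (Ideal.Quotient.mk (I * J))) (by
      rw [← RingHom.mapMatrix_apply, ← RingHom.map_det]
      rw [← Ideal.Quotient.eq_zero_iff_mem, map_sub, sub_eq_zero] at hd
      simpa using hd)
  have key : ∀ a b, N a b - N0 a b ∈ I * J := fun a b => by
    rw [← Ideal.Quotient.eq]
    exact congrFun (congrFun hN' a) b
  let b : Matrix.SpecialLinearGroup (Fin (k + 1)) R := ⟨N, hN⟩
  have hbI : Matrix.SpecialLinearGroup.map (Ideal.Quotient.mk I) b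
      = Matrix.SpecialLinearGroup.map (Ideal.Quotient.mk I) g := by
    ext x y
    exact ((Ideal.Quotient.eq).2 (Ideal.mul_le_left (key x y))).trans
      (congrFun (congrFun hNI x) y)
  have hbJ : Matrix.SpecialLinearGroup.map (Ideal.Quotient.mk J) b
      = Matrix.SpecialLinearGroup.map (Ideal.Quotient.mk J) 1 := by
    ext x y
    exact ((Ideal.Quotient.eq).2 (Ideal.mul_le_right (key x y))).trans
      (congrFun (congrFun hNJ x) y)
  refine ⟨g * b⁻¹, ?_, b, ?_, by simp⟩
  · rw [SLGamma, MonoidHom.mem_ker, map_mul, map_inv, hbI, mul_inv_cancel]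
  · rw [SLGamma, MonoidHom.mem_ker, hbJ, map_one]
end

section
/- Let R be a commutative ring with unity, let k ∈ ℕ, and let I, J ⊊ R be two co-maximal ideals (I + J = R) such that the product ideal I·J satisfies the USC. Then Γ_k(I)·Γ_k(J) = SP_{2k}(R), i.e., every element of SP_{2k}(R) is a product of an element of Γ_k(I) and an element of Γ_k(J). -/
open Matrix

section Helpers

variable {l : Type*} [DecidableEq l] [Fintype l] {S : Type*} [CommRing S]

/-- The standard symplectic form. -/
def spForm (x y : l ⊕ l → S) : S := x ⬝ᵥ (Matrix.J l S *ᵥ y)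

lemma spForm_eq (x y : l ⊕ l → S) :
    spForm x y = ∑ j, (x (Sum.inr j) * y (Sum.inl j) - x (Sum.inl j) * y (Sum.inr j)) := by
  have : Matrix.J l S *ᵥ y = Sum.elim (fun j => - y (Sum.inr j)) (fun j => y (Sum.inl j)) := by
    rw [Matrix.J, Matrix.fromBlocks_mulVec]
    simp only [Matrix.zero_mulVec, Matrix.neg_mulVec, Matrix.one_mulVec, zero_add, add_zero]
    rfl
  rw [spForm, this]
  simp only [dotProduct, Fintype.sum_sum_type, Sum.elim_inl, Sum.elim_inr, Finset.sum_sub_distrib]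
  simp only [mul_neg, Finset.sum_neg_distrib]
  ring

lemma spForm_add_left (x y z : l ⊕ l → S) : spForm (x + y) z = spForm x z + spForm y z := by
  simp [spForm, add_dotProduct]

lemma spForm_sub_left (x y z : l ⊕ l → S) : spForm (x - y) z = spForm x z - spForm y z := by
  simp [spForm, sub_dotProduct]

lemma spForm_smul_left (r : S) (y z : l ⊕ l → S) : spForm (r • y) z = r * spForm y z := by
  simp [spForm, smul_dotProduct]

lemma spForm_self (x : l ⊕ l → S) : spForm x x = 0 := by
  rw [spForm_eq]
  exact Finset.sum_eq_zero fun j _ => by ring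

lemma spForm_swap (x y : l ⊕ l → S) : spForm x y = - spForm y x := by
  rw [spForm_eq, spForm_eq, ← Finset.sum_neg_distrib]
  exact Finset.sum_congr rfl fun j _ => by ring

lemma spForm_map {M : Matrix (l ⊕ l) (l ⊕ l) S} (hM : M ∈ Matrix.symplecticGroup l S)
    (x y : l ⊕ l → S) : spForm (M *ᵥ x) (M *ᵥ y) = spForm x y := by
  rw [SymplecticGroup.mem_iff'] at hM
  rw [spForm, spForm]
  conv_rhs => rw [← hM]
  rw [← Matrix.mulVec_mulVec, ← Matrix.mulVec_mulVec, Matrix.dotProduct_mulVec x,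
    Matrix.vecMul_transpose]

lemma vecMul_J (v : l ⊕ l → S) : v ᵥ* Matrix.J l S = - (Matrix.J l S *ᵥ v) := by
  rw [← Matrix.mulVec_transpose, Matrix.J_transpose, Matrix.neg_mulVec]

/-- The symplectic transvection. -/
def spT (v : l ⊕ l → S) (r : S) : Matrix (l ⊕ l) (l ⊕ l) S :=
  1 + r • Matrix.vecMulVec v (v ᵥ* Matrix.J l S)

lemma spT_mulVec (v : l ⊕ l → S) (r : S) (x : l ⊕ l → S) :
    spT v r *ᵥ x = x + (r * spForm v x) • v := by
  rw [spT, Matrix.add_mulVec, Matrix.one_mulVec, Matrix.smul_mulVec, Matrix.vecMulVec_mulVec,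
    spForm, Matrix.dotProduct_mulVec]
  ext i
  simp
  ring

lemma spT_mem (v : l ⊕ l → S) (r : S) : spT v r ∈ Matrix.symplecticGroup l S := by
  rw [SymplecticGroup.mem_iff']
  have key : ∀ x y : l ⊕ l → S, spForm (spT v r *ᵥ x) (spT v r *ᵥ y) = spForm x y := by
    intro x y
    have h2 : ∀ a b c : l ⊕ l → S, spForm a (b + c) = spForm a b + spForm a c := by
      intro a b c
      simp [spForm, Matrix.mulVec_add, dotProduct_add]
    have h3 : ∀ (a : S) (b c : l ⊕ l → S), spForm b (a • c) = a * spForm b c := by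
      intro a b c
      simp [spForm, Matrix.mulVec_smul, dotProduct_smul]
    rw [spT_mulVec, spT_mulVec, spForm_add_left, spForm_smul_left, h2, h2, h3, h3, spForm_self,
      spForm_swap x v]
    ring
  ext i j
  have := key (Pi.single i 1) (Pi.single j 1)
  simp only [spForm] at this
  rw [← Matrix.vecMul_transpose, ← Matrix.dotProduct_mulVec, Matrix.mulVec_mulVec,
    Matrix.mulVec_mulVec] at this
  simpa [Matrix.mulVec_single_one, single_one_dotProduct, Matrix.mul_assoc] using this

/-- Abstract stable range one condition. -/
def SR1 (S : Type*) [CommRing S] (ι : Type*) [Fintype ι] : Prop :=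
  ∀ (y c : ι → S) (i : ι), c ⬝ᵥ y = 1 → ∃ r : ι → S, r i = 1 ∧ IsUnit (r ⬝ᵥ y)

/-- If `spForm x y` is a unit, a transvection moves `x` to `y`. -/
lemma spT_move (x y : l ⊕ l → S) (u : S) (hu : u * spForm y x = 1) :
    spT (y - x) u *ᵥ x = y := by
  rw [spT_mulVec, spForm_sub_left, spForm_self, sub_zero, hu, one_smul]
  abel

lemma spT_fix (v x : l ⊕ l → S) (u : S) (hu : spForm v x = 0) :
    spT v u *ᵥ x = x := by
  rw [spT_mulVec, hu]
  simp

set_option maxHeartbeats 1000000 in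
theorem sp_generated (hS : SR1 S (l ⊕ l)) (H : Subgroup (Matrix.symplecticGroup l S))
    (hH : ∀ v r, (⟨spT v r, spT_mem v r⟩ : Matrix.symplecticGroup l S) ∈ H) (t : Finset l) :
    ∀ M : Matrix.symplecticGroup l S,
      (∀ j, j ∉ t → M.1 *ᵥ Pi.single (Sum.inl j) 1 = Pi.single (Sum.inl j) 1 ∧
        M.1 *ᵥ Pi.single (Sum.inr j) 1 = Pi.single (Sum.inr j) 1) → M ∈ H := by
  induction t using Finset.induction_on with
  | empty =>
    intro M hM
    have : M = 1 := by
      apply Subtype.ext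
      apply Matrix.ext_of_mulVec_single
      rintro (j | j)
      · rw [(hM j (by simp)).1, Submonoid.coe_one, Matrix.one_mulVec]
      · rw [(hM j (by simp)).2, Submonoid.coe_one, Matrix.one_mulVec]
    rw [this]
    exact H.one_mem
  | insert i t hi ih =>
    -- moving by a transvection
    have step : ∀ (v : l ⊕ l → S) (r : S) (M : Matrix.symplecticGroup l S),
        (⟨spT v r, spT_mem v r⟩ * M : Matrix.symplecticGroup l S) ∈ H → M ∈ H :=
      fun v r M h => (H.mul_mem_cancel_left (hH v r)).1 h
    have fl : ∀ (x : l ⊕ l → S) j, spForm x (Pi.single (Sum.inl j) 1) = x (Sum.inr j) := by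
      intro x j
      rw [spForm_eq]
      simp [Pi.single_apply]
    have fr : ∀ (x : l ⊕ l → S) j, spForm x (Pi.single (Sum.inr j) 1) = - x (Sum.inl j) := by
      intro x j
      rw [spForm_eq]
      simp [Pi.single_apply]
    -- a transvection along a vector supported on `insert i t` preserves the fixed vectors
    have keep : ∀ (v : l ⊕ l → S) (r : S) (M : Matrix.symplecticGroup l S),
        (∀ j, j ∉ insert i t → v (Sum.inl j) = 0 ∧ v (Sum.inr j) = 0) →
        (∀ j, j ∉ insert i t → M.1 *ᵥ Pi.single (Sum.inl j) 1 = Pi.single (Sum.inl j) 1 ∧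
          M.1 *ᵥ Pi.single (Sum.inr j) 1 = Pi.single (Sum.inr j) 1) →
        (∀ j, j ∉ insert i t →
          (⟨spT v r, spT_mem v r⟩ * M : Matrix.symplecticGroup l S).1 *ᵥ Pi.single (Sum.inl j) 1 = Pi.single (Sum.inl j) 1 ∧
          (⟨spT v r, spT_mem v r⟩ * M : Matrix.symplecticGroup l S).1 *ᵥ Pi.single (Sum.inr j) 1 = Pi.single (Sum.inr j) 1) := by
      intro v r M hv hM j hj
      change (spT v r * M.1) *ᵥ _ = _ ∧ (spT v r * M.1) *ᵥ _ = _
      rw [← Matrix.mulVec_mulVec, ← Matrix.mulVec_mulVec, (hM j hj).1, (hM j hj).2]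
      refine ⟨spT_fix _ _ _ ?_, spT_fix _ _ _ ?_⟩
      · rw [fl, (hv j hj).2]
      · rw [fr, (hv j hj).1, neg_zero]
    -- images of basis vectors are supported on `insert i t`
    have supp : ∀ (M : Matrix.symplecticGroup l S),
        (∀ j, j ∉ insert i t → M.1 *ᵥ Pi.single (Sum.inl j) 1 = Pi.single (Sum.inl j) 1 ∧
          M.1 *ᵥ Pi.single (Sum.inr j) 1 = Pi.single (Sum.inr j) 1) →
        ∀ x : l ⊕ l → S, (∀ j, j ∉ insert i t → x (Sum.inl j) = 0 ∧ x (Sum.inr j) = 0) →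
        (∀ j, j ∉ insert i t → (M.1 *ᵥ x) (Sum.inl j) = 0 ∧ (M.1 *ᵥ x) (Sum.inr j) = 0) := by
      intro M hM x hx j hj
      have h1 := spForm_map M.2 x (Pi.single (Sum.inl j) 1)
      have h2 := spForm_map M.2 x (Pi.single (Sum.inr j) 1)
      rw [(hM j hj).1, fl, fl] at h1
      rw [(hM j hj).2, fr, fr] at h2
      rw [h1, neg_inj.1 h2]
      exact hx j hj
    have hel : ∀ j, j ∉ insert i t → (Pi.single (Sum.inl i) 1 : l ⊕ l → S) (Sum.inl j) = 0 ∧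
        (Pi.single (Sum.inl i) 1 : l ⊕ l → S) (Sum.inr j) = 0 := by
      intro j hj
      have : j ≠ i := fun h => hj (h ▸ Finset.mem_insert_self _ _)
      simp [Pi.single_apply, this]
    have her : ∀ j, j ∉ insert i t → (Pi.single (Sum.inr i) 1 : l ⊕ l → S) (Sum.inl j) = 0 ∧
        (Pi.single (Sum.inr i) 1 : l ⊕ l → S) (Sum.inr j) = 0 := by
      intro j hj
      have : j ≠ i := fun h => hj (h ▸ Finset.mem_insert_self _ _)
      simp [Pi.single_apply, this]
    have hsub : ∀ x y : l ⊕ l → S,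
        (∀ j, j ∉ insert i t → x (Sum.inl j) = 0 ∧ x (Sum.inr j) = 0) →
        (∀ j, j ∉ insert i t → y (Sum.inl j) = 0 ∧ y (Sum.inr j) = 0) →
        (∀ j, j ∉ insert i t → (x - y) (Sum.inl j) = 0 ∧ (x - y) (Sum.inr j) = 0) := by
      intro x y hx hy j hj
      simp [hx j hj, hy j hj]
    -- Stage 3: both `e` fixed and `spForm` of image of `f` with `f` a unit
    have stage3 : ∀ M : Matrix.symplecticGroup l S,
        (∀ j, j ∉ insert i t → M.1 *ᵥ Pi.single (Sum.inl j) 1 = Pi.single (Sum.inl j) 1 ∧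
          M.1 *ᵥ Pi.single (Sum.inr j) 1 = Pi.single (Sum.inr j) 1) →
        M.1 *ᵥ Pi.single (Sum.inl i) 1 = Pi.single (Sum.inl i) 1 →
        spForm (Pi.single (Sum.inr i) 1) (M.1 *ᵥ Pi.single (Sum.inr i) 1) = 1 → M ∈ H := by
      intro M hM he hf
      apply step (Pi.single (Sum.inr i) 1 - M.1 *ᵥ Pi.single (Sum.inr i) 1) 1
      apply ih
      have hk := keep (Pi.single (Sum.inr i) 1 - M.1 *ᵥ Pi.single (Sum.inr i) 1) 1 M
        (hsub _ _ her (supp M hM _ her)) hM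
      intro j hj
      by_cases hji : j = i
      · subst hji
        constructor
        · change (spT _ _ * M.1) *ᵥ _ = _
          rw [← Matrix.mulVec_mulVec, he]
          apply spT_fix
          have h1 := spForm_map M.2 (Pi.single (Sum.inr j) 1) (Pi.single (Sum.inl j) 1)
          rw [he] at h1
          rw [spForm_sub_left, h1, sub_self]
        · change (spT _ _ * M.1) *ᵥ _ = _
          rw [← Matrix.mulVec_mulVec]
          exact spT_move _ _ _ (by rw [hf, one_mul])
      · exact hk j (by simp [hji, hj])
    -- Stage 2: `e` fixed
    have stage2 : ∀ M : Matrix.symplecticGroup l S,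
        (∀ j, j ∉ insert i t → M.1 *ᵥ Pi.single (Sum.inl j) 1 = Pi.single (Sum.inl j) 1 ∧
          M.1 *ᵥ Pi.single (Sum.inr j) 1 = Pi.single (Sum.inr j) 1) →
        M.1 *ᵥ Pi.single (Sum.inl i) 1 = Pi.single (Sum.inl i) 1 → M ∈ H := by
      intro M hM he
      have h1 := spForm_map M.2 (Pi.single (Sum.inr i) 1) (Pi.single (Sum.inl i) 1)
      rw [he, fl, fl, Pi.single_eq_same] at h1
      set y := M.1 *ᵥ Pi.single (Sum.inr i) 1 with hy
      have h2 : spForm (Pi.single (Sum.inl i) 1) y = -1 := by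
        rw [spForm_swap, fl, h1]
      apply step (Pi.single (Sum.inl i) 1) (y (Sum.inl i) - 1)
      apply stage3
      · exact keep _ _ _ hel hM
      · change (spT _ _ * M.1) *ᵥ _ = _
        rw [← Matrix.mulVec_mulVec, he]
        exact spT_fix _ _ _ (spForm_self _)
      · change spForm _ ((spT _ _ * M.1) *ᵥ _) = _
        rw [← Matrix.mulVec_mulVec, ← hy, spForm_swap, fr, spT_mulVec, h2]
        simp
    -- Stage 1
    intro M hM
    set x := M.1 *ᵥ Pi.single (Sum.inl i) 1 with hx
    have hxs := supp M hM _ hel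
    rw [← hx] at hxs
    obtain ⟨r, hr1, hr⟩ := hS x ((M.1 *ᵥ Pi.single (Sum.inr i) 1) ᵥ* Matrix.J l S) (Sum.inl i) (by
      rw [← Matrix.dotProduct_mulVec]
      change spForm _ _ = 1
      rw [hx, spForm_map M.2, fl, Pi.single_eq_same])
    -- the intermediate vector
    let z : l ⊕ l → S := Sum.elim (fun j => if j ∈ insert i t then - r (Sum.inr j) else 0)
      (fun j => if j ∈ insert i t then r (Sum.inl j) else 0)
    have hz0 : ∀ j, j ∉ insert i t → z (Sum.inl j) = 0 ∧ z (Sum.inr j) = 0 := by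
      intro j hj
      simp only [z, Sum.elim_inl, Sum.elim_inr, if_neg hj, and_self]
    have hzx : spForm z x = r ⬝ᵥ x := by
      rw [spForm_eq]
      simp only [dotProduct, Fintype.sum_sum_type, ← Finset.sum_add_distrib]
      refine Finset.sum_congr rfl fun j _ => ?_
      by_cases hj : j ∈ insert i t
      · simp only [z, Sum.elim_inl, Sum.elim_inr, if_pos hj]; ring
      · rw [(hz0 j hj).1, (hz0 j hj).2, (hxs j hj).1, (hxs j hj).2]; ring
    have hze : spForm z (Pi.single (Sum.inl i) 1) = 1 := by
      rw [fl]
      simp [z, hr1]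
    obtain ⟨u, hu⟩ := hr.exists_left_inv
    rw [← hzx] at hu
    apply step (z - x) u
    apply step (Pi.single (Sum.inl i) 1 - z) (-1)
    have k1 := keep (z - x) u M (hsub _ _ hz0 hxs) hM
    have k1' : (⟨spT (z - x) u, spT_mem _ _⟩ * M : Matrix.symplecticGroup l S).1 *ᵥ
        Pi.single (Sum.inl i) 1 = z := by
      change (spT _ _ * M.1) *ᵥ _ = _
      rw [← Matrix.mulVec_mulVec, ← hx, spT_move _ _ _ hu]
    generalize (⟨spT (z - x) u, spT_mem _ _⟩ * M : Matrix.symplecticGroup l S) = M1 at k1 k1' ⊢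
    have k2 := keep (Pi.single (Sum.inl i) 1 - z) (-1) M1 (hsub _ _ hel hz0) k1
    refine stage2 _ k2 ?_
    change (spT _ _ * M1.1) *ᵥ _ = _
    rw [← Matrix.mulVec_mulVec, k1']
    apply spT_move
    rw [spForm_swap, hze]
    ring

lemma SR1_of_USC {R : Type*} [CommRing R] (K : Ideal R) (hK : SatisfiesUSC K)
    (ι : Type*) [Fintype ι] : SR1 (R ⧸ K) ι := by
  classical
  intro y c i hc
  choose s hs using (Ideal.Quotient.mk_surjective (I := K))
  let y' : ι → R := fun p => s (y p)
  let c' : ι → R := fun p => s (c p)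
  let d : R := 1 - c' ⬝ᵥ y'
  have hd : d ∈ K := by
    rw [← Ideal.Quotient.eq_zero_iff_mem]
    simp only [d, dotProduct, map_sub, map_one, map_sum, map_mul, y', c', hs]
    rw [← hc]
    simp [dotProduct]
  let n := Fintype.card {p : ι // p ≠ i}
  let e : Option {p : ι // p ≠ i} ≃ Fin (n + 1) :=
    Fintype.equivFinOfCardEq (by simp [n])
  let g : Option {p : ι // p ≠ i} → R := fun o => o.elim d (fun p => y' p.1)
  let a : Fin (n + 2) → R := Fin.cons (y' i) (g ∘ e.symm)
  have hmem : ∀ o, g o ∈ Ideal.span (Set.range a) := fun o =>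
    Ideal.subset_span ⟨(e o).succ, by simp [a]⟩
  have hy : ∀ p, y' p ∈ Ideal.span (Set.range a) := by
    intro p
    by_cases hp : p = i
    · exact Ideal.subset_span ⟨0, by simp [a, hp]⟩
    · exact hmem (some ⟨p, hp⟩)
  have htop : Ideal.span (Set.range a) = ⊤ := by
    rw [Ideal.eq_top_iff_one]
    have : (1 : R) = d + c' ⬝ᵥ y' := by simp [d]
    rw [this]
    exact Ideal.add_mem _ (hmem none) (Ideal.sum_mem _ fun p _ => Ideal.mul_mem_left _ _ (hy p))
  obtain ⟨b, hb, hu⟩ := hK n a htop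
  have hrange : (Set.range fun j : Fin (n + 1) => a j.succ) = Set.range g := by
    have : (fun j : Fin (n + 1) => a j.succ) = g ∘ e.symm := by
      ext j; simp [a]
    rw [this, EquivLike.range_comp]
  rw [hrange, Ideal.mem_span_range_iff_exists_fun] at hb
  obtain ⟨q, hq⟩ := hb
  let r : ι → R := fun p => if hp : p = i then 1 else q (some ⟨p, hp⟩)
  refine ⟨fun p => Ideal.Quotient.mk K (r p), by simp [r], ?_⟩
  convert hu using 1
  have h1 : a 0 + b = r ⬝ᵥ y' + q none * d := by
    rw [← hq, Fintype.sum_option]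
    have : r ⬝ᵥ y' = y' i + ∑ p : {p : ι // p ≠ i}, q (some p) * y' p.1 := by
      rw [dotProduct, Fintype.sum_eq_add_sum_subtype_ne _ i]
      congr 1
      · simp [r]
      · refine Finset.sum_congr rfl fun p _ => ?_
        simp [r, p.2]
    rw [this]
    simp [a, g]
    ring
  rw [h1, map_add, map_mul, Ideal.Quotient.eq_zero_iff_mem.2 hd]
  simp [dotProduct, y', hs]

lemma SpMap_surj {R : Type*} [CommRing R] (K : Ideal R) (hK : SatisfiesUSC K) :
    Function.Surjective (SpMap (l := l) (Ideal.Quotient.mk K)) := by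
  rw [← MonoidHom.range_eq_top, Subgroup.eq_top_iff']
  intro M
  refine sp_generated (SR1_of_USC K hK _) _ ?_ Finset.univ M (by simp)
  intro v r
  choose s hs using (Ideal.Quotient.mk_surjective (I := K))
  refine ⟨⟨spT (fun p => s (v p)) (s r), spT_mem _ _⟩, Subtype.ext ?_⟩
  change (spT (fun p => s (v p)) (s r)).map (Ideal.Quotient.mk K) = spT v r
  ext p q
  simp only [spT, Matrix.map_apply, Matrix.add_apply, Matrix.smul_apply, Matrix.vecMulVec_apply,
    Matrix.vecMul, dotProduct, map_add, smul_eq_mul, map_mul, map_sum, hs]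
  rw [← J_map (Ideal.Quotient.mk K)]
  simp [Matrix.one_apply, apply_ite (Ideal.Quotient.mk K)]

end Helpers

theorem stmt10 {R : Type*} [CommRing R] (k : ℕ) (I J : Ideal R)
    (hI : I ≠ ⊤) (hJ : J ≠ ⊤) (hco : I ⊔ J = ⊤) (hUSC : SatisfiesUSC (I * J)) :
    ∀ g : Matrix.symplecticGroup (Fin k) R,
      ∃ a ∈ SpGamma k I, ∃ b ∈ SpGamma k J, g = a * b := by
  intro g
  obtain ⟨u, hu, v, hv, huv⟩ := Submodule.mem_sup.1 ((Ideal.eq_top_iff_one _).1 hco)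
  let N : Matrix (Fin k ⊕ Fin k) (Fin k ⊕ Fin k) R := v • 1 + u • g.1
  have hN : N.map (Ideal.Quotient.mk (I * J)) ∈ Matrix.symplecticGroup (Fin k) (R ⧸ (I * J)) := by
    rw [SymplecticGroup.mem_iff, ← J_map (Ideal.Quotient.mk (I * J)), ← Matrix.transpose_map,
      ← Matrix.map_mul, ← Matrix.map_mul]
    have hg := SymplecticGroup.mem_iff.1 g.2
    have h1 : N * Matrix.J (Fin k) R * Nᵀ = Matrix.J (Fin k) R + (u * v) •
        (g.1 * Matrix.J (Fin k) R + Matrix.J (Fin k) R * g.1ᵀ - (2 : R) • Matrix.J (Fin k) R) := by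
      have h2 : N * Matrix.J (Fin k) R * Nᵀ = (v * v) • Matrix.J (Fin k) R +
          (u * v) • (g.1 * Matrix.J (Fin k) R + Matrix.J (Fin k) R * g.1ᵀ) +
          (u * u) • (g.1 * Matrix.J (Fin k) R * g.1ᵀ) := by
        simp only [N, Matrix.transpose_add, Matrix.transpose_smul, Matrix.transpose_one,
          Matrix.add_mul, Matrix.mul_add, Matrix.smul_mul, Matrix.mul_smul, Matrix.one_mul,
          Matrix.mul_one]
        module
      rw [h2, hg]
      have h3 : v = 1 - u := by rw [← huv]; ring
      rw [h3]
      module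
    rw [h1]
    ext p q
    have : Ideal.Quotient.mk (I * J) (u * v) = 0 :=
      Ideal.Quotient.eq_zero_iff_mem.2 (Ideal.mul_mem_mul hu hv)
    simp only [Matrix.map_apply, Matrix.add_apply, Matrix.smul_apply, smul_eq_mul, map_add,
      map_mul (Ideal.Quotient.mk (I * J)) (u * v), this, zero_mul, add_zero]
  obtain ⟨a, ha⟩ := SpMap_surj (I * J) hUSC ⟨_, hN⟩
  have haN : ∀ p q, a.1 p q - N p q ∈ I * J := by
    intro p q
    rw [← Ideal.Quotient.eq]
    exact congrFun (congrFun (congrArg Subtype.val ha) p) q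
  refine ⟨a, ?_, a⁻¹ * g, ?_, by simp⟩
  · refine MonoidHom.mem_ker.2 (Subtype.ext ?_)
    ext p q
    change Ideal.Quotient.mk I (a.1 p q) = (1 : Matrix _ _ (R ⧸ I)) p q
    rw [Ideal.Quotient.eq.2 (Ideal.mul_le_left (haN p q))]
    have hu0 : Ideal.Quotient.mk I u = 0 := Ideal.Quotient.eq_zero_iff_mem.2 hu
    have hv1 : Ideal.Quotient.mk I v = 1 := by
      rw [← map_one (Ideal.Quotient.mk I), ← huv, map_add, hu0, zero_add]
    simp [N, hu0, hv1, Matrix.one_apply, apply_ite (Ideal.Quotient.mk I)]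
  · refine MonoidHom.mem_ker.2 ?_
    rw [map_mul, map_inv, inv_mul_eq_one]
    refine Subtype.ext ?_
    ext p q
    change Ideal.Quotient.mk J (a.1 p q) = Ideal.Quotient.mk J (g.1 p q)
    rw [Ideal.Quotient.eq.2 (Ideal.mul_le_right (haN p q))]
    have hv0 : Ideal.Quotient.mk J v = 0 := Ideal.Quotient.eq_zero_iff_mem.2 hv
    have hu1 : Ideal.Quotient.mk J u = 1 := by
      rw [← map_one (Ideal.Quotient.mk J), ← huv, map_add, hv0, add_zero]
    simp [N, hv0, hu1]
end

section
/- In the polynomial ring ℤ[x], the set {x, 3x² − 1} is unital (the ideal ⟨x, 3x² − 1⟩ equals ℤ[x]), yet there is no element b ∈ ⟨3x² − 1⟩ such that x + b is a unit modulo the ideal ⟨5⟩. Consequently, the ideal ⟨5⟩ does not satisfy the USC in ℤ[x]. -/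
open Matrix

open Polynomial in
theorem stmt13_unital :
    Ideal.span {(Polynomial.X : Polynomial ℤ), 3 * Polynomial.X ^ 2 - 1} = ⊤ := by
  rw [Ideal.eq_top_iff_one, Ideal.mem_span_pair]
  exact ⟨3 * X, -1, by ring⟩

open Polynomial in
theorem stmt13_no_unit :
    ¬ ∃ b ∈ Ideal.span {(3 * Polynomial.X ^ 2 - 1 : Polynomial ℤ)},
        IsUnit (Ideal.Quotient.mk (Ideal.span {(5 : Polynomial ℤ)}) (Polynomial.X + b)) := by
  rintro ⟨b, hb, hu⟩
  obtain ⟨c, rfl⟩ := Ideal.mem_span_singleton.1 hb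
  have : Fact (Nat.Prime 5) := ⟨by norm_num⟩
  let f : ℤ[X] →+* (ZMod 5)[X] := Polynomial.mapRingHom (Int.castRingHom (ZMod 5))
  have h5 : f 5 = 0 := by
    have h : (5 : (ZMod 5)[X]) = C (5 : ZMod 5) := rfl
    rw [map_ofNat, h, show (5 : ZMod 5) = 0 from rfl, C_0]
  have hle : ∀ a ∈ Ideal.span {(5 : ℤ[X])}, f a = 0 := by
    intro a ha
    obtain ⟨d, rfl⟩ := Ideal.mem_span_singleton.1 ha
    rw [map_mul, h5, zero_mul]
  have hu2 := hu.map (Ideal.Quotient.lift _ f hle)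
  rw [Ideal.Quotient.lift_mk] at hu2
  obtain ⟨u, -, hu3⟩ := Polynomial.isUnit_iff.1 hu2
  have hf : f (X + (3 * X ^ 2 - 1) * c) = X + (C 3 * X ^ 2 - 1) * f c := by
    have h : (C (3 : ZMod 5)) = 3 := rfl
    simp [f, h]
  rw [hf] at hu3
  have hdvd : (C 3 * X ^ 2 - 1 : (ZMod 5)[X]) ∣ X - C u :=
    ⟨-f c, by rw [hu3]; ring⟩
  have hdeg := Polynomial.natDegree_le_of_dvd hdvd (X_sub_C_ne_zero u)
  have h3 : (3 : ZMod 5) ≠ 0 := by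
    clear * -
    exact fun h => absurd (congrArg ZMod.val h) (by decide +revert)
  have hd2 : (C 3 * X ^ 2 - 1 : (ZMod 5)[X]).natDegree = 2 := by
    compute_degree!
  rw [hd2, natDegree_X_sub_C] at hdeg
  omega

theorem stmt13 :
    Ideal.span {(Polynomial.X : Polynomial ℤ), 3 * Polynomial.X ^ 2 - 1} = ⊤ ∧
    (¬ ∃ b ∈ Ideal.span {(3 * Polynomial.X ^ 2 - 1 : Polynomial ℤ)},
        IsUnit (Ideal.Quotient.mk (Ideal.span {(5 : Polynomial ℤ)}) (Polynomial.X + b))) ∧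
    ¬ SatisfiesUSC (Ideal.span {(5 : Polynomial ℤ)}) := by
  refine ⟨stmt13_unital, stmt13_no_unit, fun h => stmt13_no_unit ?_⟩
  obtain ⟨b, hb, hu⟩ := h 0 ![Polynomial.X, 3 * Polynomial.X ^ 2 - 1] (by
    rw [Matrix.range_cons, Matrix.range_cons, Matrix.range_empty, Set.union_empty]
    exact stmt13_unital)
  refine ⟨b, ?_, by simpa using hu⟩
  simpa [Set.range_unique] using hb
end

section
/- For every k ∈ ℕ, the reduction homomorphism SL_{k+1}(ℤ[x]) → SL_{k+1}(ℤ[x]/⟨5⟩) induced by the quotient map ℤ[x] → ℤ[x]/⟨5⟩ is surjective, i.e., the ideal ⟨5⟩ ⊆ ℤ[x] satisfies the strong approximation property with respect to SL_{k+1}(ℤ[x]). -/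
open Matrix

/-- `M` lifts to a determinant one matrix along `f`. -/
def SLift {R S : Type*} [CommRing R] [CommRing S] (f : R →+* S) {n : ℕ}
    (M : Matrix (Fin n) (Fin n) S) : Prop :=
  ∃ N : Matrix (Fin n) (Fin n) R, N.det = 1 ∧ N.map f = M

theorem SLift.mul {R S : Type*} [CommRing R] [CommRing S] {f : R →+* S} {n : ℕ}
    {M M' : Matrix (Fin n) (Fin n) S} (h : SLift f M) (h' : SLift f M') : SLift f (M * M') := by
  obtain ⟨N, hN, rfl⟩ := h
  obtain ⟨N', hN', rfl⟩ := h'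
  exact ⟨N * N', by rw [det_mul, hN, hN', one_mul], Matrix.map_mul⟩

theorem SLift.transvec {R S : Type*} [CommRing R] [CommRing S] {f : R →+* S}
    (hf : Function.Surjective f) {n : ℕ} {i j : Fin n} (hij : i ≠ j) (c : S) :
    SLift f (transvection i j c) := by
  obtain ⟨c, rfl⟩ := hf c
  refine ⟨transvection i j c, det_transvection_of_ne i j hij c, ?_⟩
  ext a b
  simp [transvection, Matrix.single_apply, Matrix.one_apply, apply_ite f]

theorem SLift.of_transvec_mul {R S : Type*} [CommRing R] [CommRing S] {f : R →+* S}
    (hf : Function.Surjective f) {n : ℕ} {i j : Fin n} (hij : i ≠ j) (c : S)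
    {M : Matrix (Fin n) (Fin n) S} (h : SLift f (transvection i j c * M)) : SLift f M := by
  have := (SLift.transvec hf hij (-c)).mul h
  rwa [← Matrix.mul_assoc, transvection_mul_transvection_same i j hij, neg_add_cancel,
    transvection_zero, Matrix.one_mul] at this

theorem SLift.of_one {R S : Type*} [CommRing R] [CommRing S] {f : R →+* S}
    (hf : Function.Surjective f) {n : ℕ}
    (ih : ∀ M : Matrix (Fin n) (Fin n) S, M.det = 1 → SLift f M)
    (M : Matrix (Fin (n + 1)) (Fin (n + 1)) S) (hM : M.det = 1) (h0 : M 0 0 = 1) :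
    SLift f M := by
  let e : Fin 1 ⊕ Fin n ≃ Fin (n + 1) := finSumFinEquiv.trans (finCongr (Nat.add_comm 1 n))
  have he : e (Sum.inl 0) = 0 := by
    apply Fin.ext
    simp [e]
  let A := M.submatrix e e
  have hA : A.det = 1 := by rw [← hM]; exact det_submatrix_equiv_self e M
  have hA1 : A.toBlocks₁₁ = 1 := by
    ext i j
    fin_cases i
    fin_cases j
    simp [A, toBlocks₁₁, he, h0]
  have hAb : A = fromBlocks 1 A.toBlocks₁₂ A.toBlocks₂₁ A.toBlocks₂₂ := by
    rw [← hA1, fromBlocks_toBlocks]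
  have hd : (A.toBlocks₂₂ - A.toBlocks₂₁ * A.toBlocks₁₂).det = 1 := by
    rw [← det_fromBlocks_one₁₁, ← hAb, hA]
  obtain ⟨E, hE, hE'⟩ := ih _ hd
  choose g hg using hf
  let B := A.toBlocks₁₂.map g
  let C := A.toBlocks₂₁.map g
  have hB : B.map f = A.toBlocks₁₂ := by ext; simp [B, hg]
  have hC : C.map f = A.toBlocks₂₁ := by ext; simp [C, hg]
  refine ⟨(fromBlocks 1 B C (E + C * B)).submatrix e.symm e.symm, ?_, ?_⟩
  · rw [det_submatrix_equiv_self, det_fromBlocks_one₁₁, add_sub_cancel_right, hE]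
  · have h1 : (fromBlocks 1 B C (E + C * B)).map f = A := by
      rw [fromBlocks_map, Matrix.map_add f (map_add f), Matrix.map_mul, hB, hC, hE',
        Matrix.map_one f (map_zero f) (map_one f), sub_add_cancel, ← hAb]
    rw [← submatrix_map, h1]
    simp [A]

theorem SLift.of_unit {R S : Type*} [CommRing R] [CommRing S] {f : R →+* S}
    (hf : Function.Surjective f) {n : ℕ}
    (ih : ∀ M : Matrix (Fin n) (Fin n) S, M.det = 1 → SLift f M)
    (M : Matrix (Fin (n + 1)) (Fin (n + 1)) S) (hM : M.det = 1) (i : Fin (n + 1))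
    (hi : IsUnit (M i 0)) : SLift f M := by
  obtain ⟨v, hv⟩ := hi.exists_left_inv
  have key : ∀ M : Matrix (Fin (n + 1)) (Fin (n + 1)) S, M.det = 1 → ∀ i, i ≠ 0 → ∀ v,
      v * M i 0 = 1 → SLift f M := by
    intro M hM i hi v hv
    refine SLift.of_transvec_mul hf hi.symm ((1 - M 0 0) * v) ?_
    refine SLift.of_one hf ih _ (by rw [det_mul, det_transvection_of_ne _ _ hi.symm, hM, one_mul]) ?_
    rw [transvection_mul_apply_same, mul_assoc, hv]
    ring
  by_cases h : i = 0
  · subst h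
    rcases Nat.eq_zero_or_pos n with rfl | hn
    · exact SLift.of_one hf ih M hM (by rw [← hM, det_fin_one])
    · have h1 : (⟨1, by omega⟩ : Fin (n + 1)) ≠ 0 := by simp [Fin.ext_iff]
      refine SLift.of_transvec_mul hf h1 ((1 - M ⟨1, by omega⟩ 0) * v) ?_
      refine key _ (by rw [det_mul, det_transvection_of_ne _ _ h1, hM, one_mul]) _ h1 1 ?_
      rw [transvection_mul_apply_same, mul_assoc, hv]
      ring
  · exact key M hM i h v hv

theorem SLift.of_euclidean {R S : Type*} [CommRing R] [EuclideanDomain S] {f : R →+* S}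
    (hf : Function.Surjective f) (n : ℕ) :
    ∀ M : Matrix (Fin n) (Fin n) S, M.det = 1 → SLift f M := by
  induction n with
  | zero => exact fun M _ => ⟨1, det_one, Subsingleton.elim _ _⟩
  | succ n ih =>
    have key : ∀ a : S, a ≠ 0 → ∀ (M : Matrix (Fin (n + 1)) (Fin (n + 1)) S) (i : Fin (n + 1)),
        M i 0 = a → M.det = 1 → SLift f M := by
      intro a
      induction a using (EuclideanDomain.r_wellFounded (R := S)).induction with
      | _ a iha =>
      intro ha M i hi hM
      by_cases h : ∀ j, a ∣ M j 0
      · refine SLift.of_unit hf ih M hM i ?_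
        rw [hi]
        apply isUnit_of_dvd_one
        rw [← hM, det_succ_column_zero]
        exact Finset.dvd_sum fun j _ => Dvd.dvd.mul_right (Dvd.dvd.mul_left (h j) _) _
      · push Not at h
        obtain ⟨j, hj⟩ := h
        have hji : j ≠ i := by
          rintro rfl
          exact hj (by rw [hi])
        refine SLift.of_transvec_mul hf hji (-(M j 0 / a)) ?_
        refine iha (M j 0 % a) (EuclideanDomain.mod_lt _ ha)
          (fun h => hj (EuclideanDomain.mod_eq_zero.1 h)) _ j ?_
          (by rw [det_mul, det_transvection_of_ne _ _ hji, hM, one_mul])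
        rw [transvection_mul_apply_same, hi, EuclideanDomain.mod_eq_sub_mul_div]
        ring
    intro M hM
    have : ∃ i, M i 0 ≠ 0 := by
      by_contra! h
      rw [det_eq_zero_of_column_eq_zero 0 h] at hM
      exact zero_ne_one hM
    obtain ⟨i, hi⟩ := this
    exact key _ hi M i rfl hM

theorem stmt14 (k : ℕ) :
    Function.Surjective
      (Matrix.SpecialLinearGroup.map (Ideal.Quotient.mk (Ideal.span {(5 : Polynomial ℤ)})) :
        Matrix.SpecialLinearGroup (Fin (k + 1)) (Polynomial ℤ) →*
          Matrix.SpecialLinearGroup (Fin (k + 1))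
            (Polynomial ℤ ⧸ Ideal.span {(5 : Polynomial ℤ)})) := by
  intro M
  have : Fact (Nat.Prime 5) := ⟨by norm_num⟩
  let f : Polynomial ℤ →+* Polynomial (ZMod 5) := Polynomial.mapRingHom (Int.castRingHom (ZMod 5))
  have hf : Function.Surjective f :=
    Polynomial.map_surjective _ (ZMod.ringHom_surjective _)
  have hker : ∀ p, f p = 0 ↔ p ∈ Ideal.span {(5 : Polynomial ℤ)} := by
    intro p
    rw [Ideal.mem_span_singleton, show (5 : Polynomial ℤ) = Polynomial.C 5 from rfl,
      Polynomial.C_dvd_iff_dvd_coeff, Polynomial.ext_iff]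
    refine forall_congr' fun i => ?_
    simpa [f] using ZMod.intCast_zmod_eq_zero_iff_dvd (p.coeff i) 5
  let g := Ideal.Quotient.lift (Ideal.span {(5 : Polynomial ℤ)}) f (fun a ha => (hker a).2 ha)
  have hg : Function.Injective g := by
    rw [injective_iff_map_eq_zero]
    intro x hx
    obtain ⟨p, rfl⟩ := Ideal.Quotient.mk_surjective x
    rw [Ideal.Quotient.eq_zero_iff_mem, ← hker]
    simpa [g] using hx
  obtain ⟨N, hN, hN'⟩ := SLift.of_euclidean hf (k + 1) (SpecialLinearGroup.map g M).1
    (SpecialLinearGroup.map g M).2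
  refine ⟨⟨N, hN⟩, ?_⟩
  ext i j
  apply hg
  have := congrFun (congrFun hN' i) j
  exact this
end

section
/- Let R = ℝ[x,y] be the polynomial ring in two variables over the real numbers and let I = ⟨x² + y² − 1⟩. Then the reduction homomorphism SL₃(R) → SL₃(R/I) induced by the quotient map R → R/I is not surjective, i.e., the ideal I does not have the strong approximation property with respect to SL₃(R). In particular, the class of the 3×3 matrix with rows (x̄, −ȳ, 0), (ȳ, x̄, 0), (0, 0, 1) lies in SL₃(R/I) but is not in the image of the reduction map. -/
open Matrix

noncomputable section

/-- The ideal `⟨x² + y² − 1⟩` of `ℝ[x,y]`. -/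
def circleIdeal : Ideal (MvPolynomial (Fin 2) ℝ) :=
  Ideal.span {MvPolynomial.X 0 ^ 2 + MvPolynomial.X 1 ^ 2 - 1}

/-- The image `x̄` of `x` in `ℝ[x,y]/⟨x² + y² − 1⟩`. -/
def xbar : MvPolynomial (Fin 2) ℝ ⧸ circleIdeal :=
  Ideal.Quotient.mk circleIdeal (MvPolynomial.X 0)

/-- The image `ȳ` of `y` in `ℝ[x,y]/⟨x² + y² − 1⟩`. -/
def ybar : MvPolynomial (Fin 2) ℝ ⧸ circleIdeal :=
  Ideal.Quotient.mk circleIdeal (MvPolynomial.X 1)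

lemma xbar_sq_add_ybar_sq : xbar ^ 2 + ybar ^ 2 = 1 := by
  have h0 : Ideal.Quotient.mk circleIdeal
      (MvPolynomial.X 0 ^ 2 + MvPolynomial.X 1 ^ 2 - 1) = 0 :=
    Ideal.Quotient.eq_zero_iff_mem.mpr (Ideal.subset_span rfl)
  have h1 : xbar ^ 2 + ybar ^ 2 - 1 = Ideal.Quotient.mk circleIdeal
      (MvPolynomial.X 0 ^ 2 + MvPolynomial.X 1 ^ 2 - 1) := by
    simp [xbar, ybar, map_sub, map_add, map_pow]
  have h2 : xbar ^ 2 + ybar ^ 2 - 1 = 0 := h1.trans h0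
  linear_combination h2

lemma rot_det_one :
    Matrix.det !![xbar, -ybar, 0; ybar, xbar, 0; 0, 0, 1] = 1 := by
  rw [Matrix.det_fin_three]
  simp
  linear_combination xbar_sq_add_ybar_sq

section Helpers
open scoped Quaternion

/-- quaternion from components -/
def mkQ (a b c d : ℝ) : Quaternion ℝ := ⟨a, b, c, d⟩

@[simp] lemma mkQ_re (a b c d : ℝ) : (mkQ a b c d).re = a := rfl
@[simp] lemma mkQ_imI (a b c d : ℝ) : (mkQ a b c d).imI = b := rfl
@[simp] lemma mkQ_imJ (a b c d : ℝ) : (mkQ a b c d).imJ = c := rfl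
@[simp] lemma mkQ_imK (a b c d : ℝ) : (mkQ a b c d).imK = d := rfl

/-- pure quaternion of a vector -/
def pureQ (v : Fin 3 → ℝ) : Quaternion ℝ := mkQ 0 (v 0) (v 1) (v 2)

/-- unnormalised lift of a rotation -/
def liftQ (G : Matrix (Fin 3) (Fin 3) ℝ) : Quaternion ℝ :=
  mkQ (1 + (G 0 0 + G 1 1 + G 2 2)) (G 2 1 - G 1 2) (G 0 2 - G 2 0) (G 1 0 - G 0 1)

@[simp] lemma pureQ_re (v : Fin 3 → ℝ) : (pureQ v).re = 0 := rfl
@[simp] lemma pureQ_imI (v : Fin 3 → ℝ) : (pureQ v).imI = v 0 := rfl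
@[simp] lemma pureQ_imJ (v : Fin 3 → ℝ) : (pureQ v).imJ = v 1 := rfl
@[simp] lemma pureQ_imK (v : Fin 3 → ℝ) : (pureQ v).imK = v 2 := rfl
@[simp] lemma liftQ_re (G : Matrix (Fin 3) (Fin 3) ℝ) :
    (liftQ G).re = 1 + (G 0 0 + G 1 1 + G 2 2) := rfl
@[simp] lemma liftQ_imI (G : Matrix (Fin 3) (Fin 3) ℝ) : (liftQ G).imI = G 2 1 - G 1 2 := rfl
@[simp] lemma liftQ_imJ (G : Matrix (Fin 3) (Fin 3) ℝ) : (liftQ G).imJ = G 0 2 - G 2 0 := rfl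
@[simp] lemma liftQ_imK (G : Matrix (Fin 3) (Fin 3) ℝ) : (liftQ G).imK = G 1 0 - G 0 1 := rfl

/-- conjugate of the standard lift of the rotation loop -/
def cQ (t : ℝ) : Quaternion ℝ := mkQ (Real.cos (t / 2)) 0 0 (-Real.sin (t / 2))

@[simp] lemma cQ_re (t : ℝ) : (cQ t).re = Real.cos (t / 2) := rfl
@[simp] lemma cQ_imI (t : ℝ) : (cQ t).imI = 0 := rfl
@[simp] lemma cQ_imJ (t : ℝ) : (cQ t).imJ = 0 := rfl
@[simp] lemma cQ_imK (t : ℝ) : (cQ t).imK = -Real.sin (t / 2) := rfl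

lemma liftQ_spec (G : Matrix (Fin 3) (Fin 3) ℝ) (ho : G * Gᵀ = 1) (hd : G.det = 1)
    (v : Fin 3 → ℝ) : liftQ G * pureQ v = pureQ (G *ᵥ v) * liftQ G := by
  have ho' : Gᵀ * G = 1 := mul_eq_one_comm.mp ho
  have hadj : G.adjugate = Gᵀ := by
    calc G.adjugate = (Gᵀ * G) * G.adjugate := by rw [ho', one_mul]
      _ = Gᵀ * (G * G.adjugate) := by rw [mul_assoc]
      _ = Gᵀ := by rw [Matrix.mul_adjugate, hd]; simp
  rw [Matrix.adjugate_fin_three] at hadj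
  have e1 := fun i j => congrFun (congrFun ho i) j
  have e2 := fun i j => congrFun (congrFun ho' i) j
  have e3 := fun i j => congrFun (congrFun hadj i) j
  simp only [Matrix.mul_apply, Fin.sum_univ_three, Matrix.transpose_apply] at e1 e2
  have a00 := e3 0 0
  have a01 := e3 0 1
  have a02 := e3 0 2
  have a10 := e3 1 0
  have a11 := e3 1 1
  have a12 := e3 1 2
  have a20 := e3 2 0
  have a21 := e3 2 1
  have a22 := e3 2 2
  have b00 := e1 0 0
  have b01 := e1 0 1
  have b02 := e1 0 2
  have b11 := e1 1 1
  have b12 := e1 1 2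
  have b22 := e1 2 2
  have c00 := e2 0 0
  have c01 := e2 0 1
  have c02 := e2 0 2
  have c11 := e2 1 1
  have c12 := e2 1 2
  have c22 := e2 2 2
  clear e1 e2 e3 hadj ho ho' hd
  simp at a00 a01 a02 a10 a11 a12 a20 a21 a22 b00 b01 b02 b11 b12 b22 c00 c01 c02 c11 c12 c22
  have key : ∀ i : Fin 3, liftQ G * pureQ (Pi.single i 1) =
      pureQ (G *ᵥ (Pi.single i 1)) * liftQ G := by
    intro i
    fin_cases i <;> ext <;>
      simp [Matrix.mulVec, dotProduct, Fin.sum_univ_three] <;> linarith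
  have hv : pureQ v = v 0 • pureQ (Pi.single 0 1) + v 1 • pureQ (Pi.single 1 1)
      + v 2 • pureQ (Pi.single 2 1) := by
    ext <;> simp
  have hGv : pureQ (G *ᵥ v) = v 0 • pureQ (G *ᵥ Pi.single 0 1) + v 1 • pureQ (G *ᵥ Pi.single 1 1)
      + v 2 • pureQ (G *ᵥ Pi.single 2 1) := by
    ext <;> simp [Matrix.mulVec, dotProduct, Fin.sum_univ_three] <;> ring
  rw [hv, hGv]
  simp only [mul_add, add_mul, mul_smul_comm, smul_mul_assoc, key]

lemma continuous_quat {X : Type*} [TopologicalSpace X] (a b c d : X → ℝ) (ha : Continuous a)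
    (hb : Continuous b) (hc : Continuous c) (hd : Continuous d) :
    Continuous (fun x => mkQ (a x) (b x) (c x) (d x)) := by
  have : (fun x => mkQ (a x) (b x) (c x) (d x)) =
      fun x => a x • (1 : Quaternion ℝ) + b x • mkQ 0 1 0 0
        + c x • mkQ 0 0 1 0 + d x • mkQ 0 0 0 1 := by
    funext x
    ext <;> simp
  rw [this]
  fun_prop

lemma real_of_commute (E : Quaternion ℝ) (h : ∀ v, E * pureQ v = pureQ v * E) :
    E.imI = 0 ∧ E.imJ = 0 ∧ E.imK = 0 := by
  have h1 := h ![1, 0, 0]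
  have h2 := h ![0, 1, 0]
  have j1 := congrArg QuaternionAlgebra.imK h1
  have k1 := congrArg QuaternionAlgebra.imJ h1
  have i2 := congrArg QuaternionAlgebra.imK h2
  simp at j1 k1 i2
  refine ⟨?_, ?_, ?_⟩ <;> linarith

lemma step_pos (A B : Matrix (Fin 3) (Fin 3) ℝ) (hA : A * Aᵀ = 1) (hB : B * Bᵀ = 1)
    (h : ∀ i j, |A i j - B i j| ≤ 1 / 2) : liftQ (A * Bᵀ) ≠ 0 := by
  intro h0
  have hr := congrArg QuaternionAlgebra.re h0
  have ea := fun i => congrFun (congrFun hA i) i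
  have eb := fun i => congrFun (congrFun hB i) i
  have sq : ∀ i j, (A i j - B i j) ^ 2 ≤ 1 / 4 := by
    intro i j
    have := abs_le.mp (h i j)
    nlinarith
  simp only [Matrix.mul_apply, Fin.sum_univ_three, Matrix.transpose_apply, liftQ_re,
    Matrix.one_apply_eq, Quaternion.re_zero] at hr ea eb
  have := ea 0
  have := ea 1
  have := ea 2
  have := eb 0
  have := eb 1
  have := eb 2
  linarith [sq 0 0, sq 0 1, sq 0 2, sq 1 0, sq 1 1, sq 1 2, sq 2 0, sq 2 1, sq 2 2]

lemma no_ext (Q : ℝ → ℝ → Matrix (Fin 3) (Fin 3) ℝ) (hc : Continuous (Function.uncurry Q))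
    (ho : ∀ s t, Q s t * (Q s t)ᵀ = 1) (hd : ∀ s t, (Q s t).det = 1)
    (h0 : ∀ t, Q 0 t = Q 0 0) (hper : ∀ s, Q s (2 * Real.pi) = Q s 0)
    (h1 : ∀ t, Q 1 t = !![Real.cos t, -Real.sin t, 0; Real.sin t, Real.cos t, 0; 0, 0, 1]) :
    False := by
  -- uniform continuity
  obtain ⟨n, hn⟩ : ∃ n : ℕ, ∀ s ∈ Set.Icc (0 : ℝ) 1, ∀ s' ∈ Set.Icc (0 : ℝ) 1,
      ∀ t ∈ Set.Icc (0 : ℝ) (2 * Real.pi), |s - s'| ≤ 1 / ((n : ℝ) + 1) →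
      ∀ i j, |Q s t i j - Q s' t i j| ≤ 1 / 2 := by
    have hK : IsCompact (Set.Icc (0 : ℝ) 1 ×ˢ Set.Icc (0 : ℝ) (2 * Real.pi)) :=
      isCompact_Icc.prod isCompact_Icc
    let f : ℝ × ℝ → (Fin 3 → Fin 3 → ℝ) := fun p i j => Q p.1 p.2 i j
    have hf : Continuous f := by
      refine continuous_pi fun i => continuous_pi fun j => ?_
      exact hc.matrix_elem i j
    have hu := hK.uniformContinuousOn_of_continuous hf.continuousOn
    rw [Metric.uniformContinuousOn_iff] at hu
    obtain ⟨δ, hδ, H⟩ := hu (1 / 2) (by norm_num)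
    obtain ⟨n, hn⟩ := exists_nat_one_div_lt hδ
    refine ⟨n, fun s hs s' hs' t ht hss i j => ?_⟩
    have := H (s, t) ⟨hs, ht⟩ (s', t) ⟨hs', ht⟩ (by
      rw [Prod.dist_eq]
      simp only [dist_self, Real.dist_eq]
      exact max_lt (lt_of_le_of_lt hss hn) hδ)
    have h2 := (dist_pi_lt_iff (by norm_num)).mp ((dist_pi_lt_iff (by norm_num)).mp this i) j
    rw [Real.dist_eq] at h2
    exact h2.le
  have hcQ : ∀ s i j, Continuous (fun t => Q s t i j) := by
    intro s i j
    have : Continuous (fun t : ℝ => Function.uncurry Q (s, t)) := hc.comp (by fun_prop)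
    exact this.matrix_elem i j
  have lifts : ∀ k : ℕ, k ≤ n + 1 → ∃ P : ℝ → Quaternion ℝ, Continuous P ∧
      P (2 * Real.pi) = P 0 ∧ ∀ t ∈ Set.Icc (0 : ℝ) (2 * Real.pi), P t ≠ 0 ∧
        ∀ v, P t * pureQ (Q 0 0 *ᵥ v) = pureQ (Q (k / ((n : ℝ) + 1)) t *ᵥ v) * P t := by
    intro k
    induction k with
    | zero =>
      intro _
      refine ⟨fun _ => 1, continuous_const, rfl, fun t _ => ⟨one_ne_zero, fun v => ?_⟩⟩
      simp [h0 t]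
    | succ k ih =>
      intro hk
      obtain ⟨P, hP, hPp, hPt⟩ := ih (by omega)
      set s : ℝ := k / ((n : ℝ) + 1) with hs
      set s' : ℝ := ((k + 1 : ℕ) : ℝ) / ((n : ℝ) + 1) with hs'
      have hnpos : (0 : ℝ) < (n : ℝ) + 1 := by positivity
      have hk' : ((k + 1 : ℕ) : ℝ) ≤ (n : ℝ) + 1 := by exact_mod_cast hk
      have hs'm : s' ∈ Set.Icc (0 : ℝ) 1 := ⟨by positivity, (div_le_one hnpos).mpr hk'⟩
      have hsm : s ∈ Set.Icc (0 : ℝ) 1 := by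
        refine ⟨by positivity, (div_le_one hnpos).mpr ?_⟩
        push_cast at hk'
        linarith
      have hdist : |s' - s| ≤ 1 / ((n : ℝ) + 1) := by
        have : s' - s = 1 / ((n : ℝ) + 1) := by
          rw [hs, hs']; push_cast; field_simp; ring
        rw [this, abs_of_pos (by positivity)]
      have ho' : ∀ t, (Q s t)ᵀ * Q s t = 1 := fun t => mul_eq_one_comm.mp (ho s t)
      refine ⟨fun t => liftQ (Q s' t * (Q s t)ᵀ) * P t, ?_, ?_, fun t ht => ⟨?_, fun v => ?_⟩⟩
      · refine Continuous.mul ?_ hP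
        unfold liftQ
        have hG : ∀ i j, Continuous (fun t => (Q s' t * (Q s t)ᵀ) i j) := by
          intro i j
          simp only [Matrix.mul_apply, Matrix.transpose_apply]
          exact continuous_finsetSum _ fun l _ => (hcQ s' i l).mul (hcQ s j l)
        exact continuous_quat _ _ _ _
          (continuous_const.add (((hG 0 0).add (hG 1 1)).add (hG 2 2)))
          ((hG 2 1).sub (hG 1 2)) ((hG 0 2).sub (hG 2 0)) ((hG 1 0).sub (hG 0 1))
      · simp only [hper, hPp]
      · exact mul_ne_zero (step_pos _ _ (ho _ _) (ho _ _)
          (hn s' hs'm s hsm t ht hdist)) (hPt t ht).1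
      · have hGo : (Q s' t * (Q s t)ᵀ) * (Q s' t * (Q s t)ᵀ)ᵀ = 1 := by
          rw [Matrix.transpose_mul, Matrix.transpose_transpose, mul_assoc,
            ← mul_assoc (Q s t)ᵀ, ho', one_mul, ho]
        have hGd : (Q s' t * (Q s t)ᵀ).det = 1 := by
          rw [Matrix.det_mul, Matrix.det_transpose, hd, hd, one_mul]
        have := liftQ_spec _ hGo hGd (Q s t *ᵥ v)
        rw [Matrix.mulVec_mulVec, mul_assoc (Q s' t), ho', mul_one] at this
        rw [mul_assoc, (hPt t ht).2, ← mul_assoc, this, mul_assoc]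
  obtain ⟨P, hP, hPp, hPt⟩ := lifts (n + 1) le_rfl
  have e1 : ((n + 1 : ℕ) : ℝ) / ((n : ℝ) + 1) = 1 := by
    push_cast
    exact div_self (by positivity)
  rw [e1] at hPt
  have h2pi : (0 : ℝ) ≤ 2 * Real.pi := by positivity
  -- conjugate of the standard lift
  let c : ℝ → Quaternion ℝ := cQ
  have hcc : Continuous c := continuous_quat (fun t => Real.cos (t / 2)) (fun _ => 0) (fun _ => 0)
    (fun t => -Real.sin (t / 2)) (by fun_prop) (by fun_prop) (by fun_prop) (by fun_prop)
  have hc0 : ∀ t, c t ≠ 0 := by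
    intro t h
    have a := congrArg QuaternionAlgebra.re h
    have b := congrArg QuaternionAlgebra.imK h
    simp [c] at a b
    have := Real.sin_sq_add_cos_sq (t / 2)
    rw [a, b] at this
    norm_num at this
  have hcs : ∀ t v, c t * pureQ (Q 1 t *ᵥ v) = pureQ v * c t := by
    intro t v
    rw [h1]
    have hs : Real.sin t = 2 * Real.sin (t / 2) * Real.cos (t / 2) := by
      rw [← Real.sin_two_mul]; ring_nf
    have hco : Real.cos t = Real.cos (t / 2) ^ 2 - Real.sin (t / 2) ^ 2 := by
      rw [← Real.cos_two_mul']; ring_nf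
    have := Real.sin_sq_add_cos_sq (t / 2)
    rw [hs, hco]
    ext <;> simp [c, Matrix.mulVec, dotProduct, Fin.sum_univ_three] 
    · ring
    · linear_combination (Real.cos (t / 2) * v 0 - Real.sin (t / 2) * v 1) * this
    · linear_combination (Real.sin (t / 2) * v 0 + Real.cos (t / 2) * v 1) * this
    · ring
  have m0 : (0 : ℝ) ∈ Set.Icc (0 : ℝ) (2 * Real.pi) := ⟨le_rfl, h2pi⟩
  have c0 : c 0 = 1 := by ext <;> simp [c]
  have c1 : c (2 * Real.pi) = -1 := by
    have : 2 * Real.pi / 2 = Real.pi := by ring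
    ext <;> simp [c, this]
  have hP0 := (hPt 0 m0).1
  have hE0 : ∀ v, pureQ (Q 0 0 *ᵥ v) * (P 0)⁻¹ = (P 0)⁻¹ * pureQ v := by
    intro v
    have a := (hPt 0 m0).2 v
    have b := hcs 0 v
    rw [c0, one_mul, mul_one] at b
    rw [b] at a
    rw [eq_inv_mul_iff_mul_eq₀ hP0, ← mul_assoc, a, mul_assoc, mul_inv_cancel₀ hP0, mul_one]
  let E : ℝ → Quaternion ℝ := fun t => c t * P t * (P 0)⁻¹
  have hEc : Continuous E := (hcc.mul hP).mul continuous_const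
  have hEr : ∀ t ∈ Set.Icc (0 : ℝ) (2 * Real.pi), ∀ v, E t * pureQ v = pureQ v * E t := by
    intro t ht v
    calc c t * P t * (P 0)⁻¹ * pureQ v = c t * (P t * pureQ (Q 0 0 *ᵥ v)) * (P 0)⁻¹ := by
          rw [mul_assoc _ (P 0)⁻¹, ← hE0]; simp only [mul_assoc]
      _ = (c t * pureQ (Q 1 t *ᵥ v)) * P t * (P 0)⁻¹ := by
          rw [(hPt t ht).2]; simp only [mul_assoc]
      _ = pureQ v * (c t * P t * (P 0)⁻¹) := by
          rw [hcs]; simp only [mul_assoc]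
  have hre : Continuous (fun t => (E t).re) := Quaternion.continuous_re.comp hEc
  have r0 : (E 0).re = 1 := by simp [E, c0, mul_inv_cancel₀ hP0]
  have r1 : (E (2 * Real.pi)).re = -1 := by simp [E, c1, hPp, mul_inv_cancel₀ hP0]
  obtain ⟨t, ht, hz⟩ := intermediate_value_Icc' h2pi hre.continuousOn
    (show (0 : ℝ) ∈ Set.Icc _ _ by rw [r0, r1]; constructor <;> norm_num)
  obtain ⟨zi, zj, zk⟩ := real_of_commute _ (hEr t ht)
  have : E t = 0 := by
    ext
    · exact hz
    · exact zi
    · exact zj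
    · exact zk
  exact mul_ne_zero (mul_ne_zero (hc0 t) (hPt t ht).1) (inv_ne_zero hP0) this

/-- Explicit orthonormalisation of the first two columns. -/
def gs (A : Matrix (Fin 3) (Fin 3) ℝ) : Matrix (Fin 3) (Fin 3) ℝ :=
  let a : Fin 3 → ℝ := fun i => A i 0
  let b : Fin 3 → ℝ := fun i => A i 1
  let m : Fin 3 → ℝ := ![a 1 * b 2 - a 2 * b 1, a 2 * b 0 - a 0 * b 2, a 0 * b 1 - a 1 * b 0]
  let α := Real.sqrt (a 0 ^ 2 + a 1 ^ 2 + a 2 ^ 2)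
  let μ := Real.sqrt (m 0 ^ 2 + m 1 ^ 2 + m 2 ^ 2)
  let u : Fin 3 → ℝ := fun i => a i / α
  let w : Fin 3 → ℝ := fun i => m i / μ
  !![u 0, w 1 * u 2 - w 2 * u 1, w 0;
     u 1, w 2 * u 0 - w 0 * u 2, w 1;
     u 2, w 0 * u 1 - w 1 * u 0, w 2]

lemma pos_a (A : Matrix (Fin 3) (Fin 3) ℝ) (hA : A.det = 1) :
    0 < A 0 0 ^ 2 + A 1 0 ^ 2 + A 2 0 ^ 2 := by
  by_contra h
  have h0 : A 0 0 = 0 := by nlinarith [sq_nonneg (A 0 0), sq_nonneg (A 1 0), sq_nonneg (A 2 0)]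
  have h1 : A 1 0 = 0 := by nlinarith [sq_nonneg (A 0 0), sq_nonneg (A 1 0), sq_nonneg (A 2 0)]
  have h2 : A 2 0 = 0 := by nlinarith [sq_nonneg (A 0 0), sq_nonneg (A 1 0), sq_nonneg (A 2 0)]
  rw [Matrix.det_fin_three, h0, h1, h2] at hA
  norm_num at hA

lemma pos_m (A : Matrix (Fin 3) (Fin 3) ℝ) (hA : A.det = 1) :
    0 < (A 1 0 * A 2 1 - A 2 0 * A 1 1) ^ 2 + (A 2 0 * A 0 1 - A 0 0 * A 2 1) ^ 2
      + (A 0 0 * A 1 1 - A 1 0 * A 0 1) ^ 2 := by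
  rw [Matrix.det_fin_three] at hA
  have hA' : (A 1 0 * A 2 1 - A 2 0 * A 1 1) * A 0 2 + (A 2 0 * A 0 1 - A 0 0 * A 2 1) * A 1 2
      + (A 0 0 * A 1 1 - A 1 0 * A 0 1) * A 2 2 = 1 := by linarith
  generalize (A 1 0 * A 2 1 - A 2 0 * A 1 1) = x at *
  generalize (A 2 0 * A 0 1 - A 0 0 * A 2 1) = y at *
  generalize (A 0 0 * A 1 1 - A 1 0 * A 0 1) = z at *
  by_contra h
  have h0 : x = 0 := by nlinarith [sq_nonneg x, sq_nonneg y, sq_nonneg z]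
  have h1 : y = 0 := by nlinarith [sq_nonneg x, sq_nonneg y, sq_nonneg z]
  have h2 : z = 0 := by nlinarith [sq_nonneg x, sq_nonneg y, sq_nonneg z]
  rw [h0, h1, h2] at hA'
  norm_num at hA'

lemma gs_orth (A : Matrix (Fin 3) (Fin 3) ℝ) (hA : A.det = 1) :
    gs A * (gs A)ᵀ = 1 ∧ (gs A).det = 1 := by
  have ha := pos_a A hA
  have hm := pos_m A hA
  have sa := Real.sq_sqrt ha.le
  have sm := Real.sq_sqrt hm.le
  have na := (Real.sqrt_pos.mpr ha).ne'
  have nm := (Real.sqrt_pos.mpr hm).ne'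
  set α := Real.sqrt (A 0 0 ^ 2 + A 1 0 ^ 2 + A 2 0 ^ 2) with hα
  set μ := Real.sqrt ((A 1 0 * A 2 1 - A 2 0 * A 1 1) ^ 2 + (A 2 0 * A 0 1 - A 0 0 * A 2 1) ^ 2
      + (A 0 0 * A 1 1 - A 1 0 * A 0 1) ^ 2) with hμ
  obtain ⟨u0, e0⟩ : ∃ u0, u0 = A 0 0 / α := ⟨_, rfl⟩
  obtain ⟨u1, e1⟩ : ∃ u1, u1 = A 1 0 / α := ⟨_, rfl⟩
  obtain ⟨u2, e2⟩ : ∃ u2, u2 = A 2 0 / α := ⟨_, rfl⟩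
  obtain ⟨w0, f0⟩ : ∃ w0, w0 = (A 1 0 * A 2 1 - A 2 0 * A 1 1) / μ := ⟨_, rfl⟩
  obtain ⟨w1, f1⟩ : ∃ w1, w1 = (A 2 0 * A 0 1 - A 0 0 * A 2 1) / μ := ⟨_, rfl⟩
  obtain ⟨w2, f2⟩ : ∃ w2, w2 = (A 0 0 * A 1 1 - A 1 0 * A 0 1) / μ := ⟨_, rfl⟩
  have huu : u0 ^ 2 + u1 ^ 2 + u2 ^ 2 = 1 := by
    rw [e0, e1, e2]; field_simp; linarith
  have hww : w0 ^ 2 + w1 ^ 2 + w2 ^ 2 = 1 := by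
    rw [f0, f1, f2]; field_simp; linarith
  have huw : u0 * w0 + u1 * w1 + u2 * w2 = 0 := by
    rw [e0, e1, e2, f0, f1, f2]; field_simp; ring
  have hgs : gs A = !![u0, w1 * u2 - w2 * u1, w0;
     u1, w2 * u0 - w0 * u2, w1;
     u2, w0 * u1 - w1 * u0, w2] := by
    rw [e0, e1, e2, f0, f1, f2]; rfl
  have hd : (gs A).det = 1 := by
    rw [hgs, Matrix.det_fin_three]
    simp
    linear_combination (w0 ^ 2 + w1 ^ 2 + w2 ^ 2) * huu + hww -
      (u0 * w0 + u1 * w1 + u2 * w2) * huw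
  refine ⟨?_, hd⟩
  apply mul_eq_one_comm.mp
  rw [hgs]
  ext i j
  fin_cases i <;> fin_cases j <;>
    simp [Matrix.mul_apply, Fin.sum_univ_three] <;> first
      | linarith
      | ring1
      | linear_combination (w0 ^ 2 + w1 ^ 2 + w2 ^ 2) * huu + hww -
          (u0 * w0 + u1 * w1 + u2 * w2) * huw

lemma gs_cont {X : Type*} [TopologicalSpace X] (A : X → Matrix (Fin 3) (Fin 3) ℝ)
    (hA : ∀ x, (A x).det = 1) (hc : ∀ i j, Continuous fun x => A x i j) :
    Continuous fun x => gs (A x) := by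
  have na := fun x => (Real.sqrt_pos.mpr (pos_a (A x) (hA x))).ne'
  have nm := fun x => (Real.sqrt_pos.mpr (pos_m (A x) (hA x))).ne'
  have hu : ∀ i, Continuous fun x => A x i 0 /
      Real.sqrt (A x 0 0 ^ 2 + A x 1 0 ^ 2 + A x 2 0 ^ 2) := fun i =>
    (hc i 0).div (by have := hc 0 0; have := hc 1 0; have := hc 2 0; fun_prop) na
  have hs : Continuous fun x => Real.sqrt ((A x 1 0 * A x 2 1 - A x 2 0 * A x 1 1) ^ 2 +
      (A x 2 0 * A x 0 1 - A x 0 0 * A x 2 1) ^ 2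
      + (A x 0 0 * A x 1 1 - A x 1 0 * A x 0 1) ^ 2) := by
    have := hc 0 0; have := hc 1 0; have := hc 2 0
    have := hc 0 1; have := hc 1 1; have := hc 2 1
    fun_prop
  have w0 := (((hc 1 0).mul (hc 2 1)).sub ((hc 2 0).mul (hc 1 1))).div hs nm
  have w1 := (((hc 2 0).mul (hc 0 1)).sub ((hc 0 0).mul (hc 2 1))).div hs nm
  have w2 := (((hc 0 0).mul (hc 1 1)).sub ((hc 1 0).mul (hc 0 1))).div hs nm
  have u0 := hu 0
  have u1 := hu 1
  have u2 := hu 2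
  refine continuous_matrix fun i j => ?_
  fin_cases i <;> fin_cases j
  · exact u0
  · exact (w1.mul u2).sub (w2.mul u1)
  · exact w0
  · exact u1
  · exact (w2.mul u0).sub (w0.mul u2)
  · exact w1
  · exact u2
  · exact (w0.mul u1).sub (w1.mul u0)
  · exact w2

lemma not_lift (N : Matrix (Fin 3) (Fin 3) (MvPolynomial (Fin 2) ℝ)) (hN : N.det = 1)
    (h : N.map (Ideal.Quotient.mk circleIdeal) = !![xbar, -ybar, 0; ybar, xbar, 0; 0, 0, 1]) :
    False := by
  let A : ℝ × ℝ → Matrix (Fin 3) (Fin 3) ℝ := fun p => N.map (MvPolynomial.eval ![p.1, p.2])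
  have hA : ∀ p, (A p).det = 1 := by
    intro p
    have := RingHom.map_det (MvPolynomial.eval ![p.1, p.2]) N
    rw [hN, map_one] at this
    exact this.symm
  have hAc : ∀ i j, Continuous fun p => A p i j := by
    intro i j
    have h1 : Continuous fun p : ℝ × ℝ => (![p.1, p.2] : Fin 2 → ℝ) := by
      refine continuous_pi fun k => ?_
      fin_cases k
      · exact continuous_fst
      · exact continuous_snd
    exact (MvPolynomial.continuous_eval (N i j)).comp h1
  let Q : ℝ → ℝ → Matrix (Fin 3) (Fin 3) ℝ :=
    fun s t => gs (A (s * Real.cos t, s * Real.sin t))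
  have hcirc : ∀ t, A (Real.cos t, Real.sin t) =
      !![Real.cos t, -Real.sin t, 0; Real.sin t, Real.cos t, 0; 0, 0, 1] := by
    intro t
    have hI : ∀ a ∈ circleIdeal, MvPolynomial.eval ![Real.cos t, Real.sin t] a = 0 := by
      intro a ha
      obtain ⟨b, rfl⟩ := Ideal.mem_span_singleton'.mp ha
      simp
    let φ := Ideal.Quotient.lift circleIdeal (MvPolynomial.eval ![Real.cos t, Real.sin t]) hI
    have e : A (Real.cos t, Real.sin t) = (N.map (Ideal.Quotient.mk circleIdeal)).map φ := by
      ext i j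
      simp [A, φ]
    have hx : φ xbar = Real.cos t := by simp [φ, xbar]
    have hy : φ ybar = Real.sin t := by simp [φ, ybar]
    rw [e, h]
    ext i j
    fin_cases i <;> fin_cases j <;> simp [hx, hy]
  refine no_ext Q ?_ (fun s t => (gs_orth _ (hA _)).1) (fun s t => (gs_orth _ (hA _)).2)
    ?_ ?_ ?_
  · have := gs_cont A hA hAc
    exact this.comp (g := fun p => gs (A p))
      (f := fun q : ℝ × ℝ => (q.1 * Real.cos q.2, q.1 * Real.sin q.2)) (by fun_prop)
  · intro t
    simp [Q]
  · intro s
    simp [Q]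
  · intro t
    simp only [Q, one_mul, hcirc]
    have := Real.cos_sq_add_sin_sq t
    have h3 : Real.cos t * Real.cos t + Real.sin t * Real.sin t = 1 := by linarith
    ext i j
    fin_cases i <;> fin_cases j <;> simp [gs, this, h3]

end Helpers

theorem stmt15 :
    ¬ Function.Surjective
      (Matrix.SpecialLinearGroup.map (Ideal.Quotient.mk circleIdeal) :
        Matrix.SpecialLinearGroup (Fin 3) (MvPolynomial (Fin 2) ℝ) →*
          Matrix.SpecialLinearGroup (Fin 3) (MvPolynomial (Fin 2) ℝ ⧸ circleIdeal)) ∧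
    (⟨!![xbar, -ybar, 0; ybar, xbar, 0; 0, 0, 1], rot_det_one⟩ :
        Matrix.SpecialLinearGroup (Fin 3) (MvPolynomial (Fin 2) ℝ ⧸ circleIdeal)) ∉
      Set.range
        (Matrix.SpecialLinearGroup.map (Ideal.Quotient.mk circleIdeal) :
          Matrix.SpecialLinearGroup (Fin 3) (MvPolynomial (Fin 2) ℝ) →*
            Matrix.SpecialLinearGroup (Fin 3) (MvPolynomial (Fin 2) ℝ ⧸ circleIdeal)) := by
  have key : (⟨!![xbar, -ybar, 0; ybar, xbar, 0; 0, 0, 1], rot_det_one⟩ :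
        Matrix.SpecialLinearGroup (Fin 3) (MvPolynomial (Fin 2) ℝ ⧸ circleIdeal)) ∉
      Set.range
        (Matrix.SpecialLinearGroup.map (Ideal.Quotient.mk circleIdeal) :
          Matrix.SpecialLinearGroup (Fin 3) (MvPolynomial (Fin 2) ℝ) →*
            Matrix.SpecialLinearGroup (Fin 3) (MvPolynomial (Fin 2) ℝ ⧸ circleIdeal)) := by
    rintro ⟨N, hN⟩
    exact not_lift N.1 N.2 (congrArg Subtype.val hN)
  exact ⟨fun hs => key (hs _), key⟩

end
end

section
/- The ideal ⟨x² + y² − 1⟩ of the polynomial ring ℝ[x,y] in two variables over the real numbers does not satisfy the USC. -/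
open Matrix

/-- Evaluation at the point of the unit circle with angle `t`. -/
noncomputable def circEval (t : ℝ) : MvPolynomial (Fin 2) ℝ →+* ℝ :=
  MvPolynomial.eval ![Real.cos t, Real.sin t]

theorem circEval_rel (t : ℝ) :
    circEval t (MvPolynomial.X 0 ^ 2 + MvPolynomial.X 1 ^ 2 - 1) = 0 := by
  simp [circEval]

theorem circEval_cont (p : MvPolynomial (Fin 2) ℝ) : Continuous fun t => circEval t p := by
  unfold circEval
  refine (MvPolynomial.continuous_eval p).comp ?_
  refine continuous_pi fun i => ?_
  fin_cases i
  · exact Real.continuous_cos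
  · exact Real.continuous_sin

theorem stmt16 :
    ¬ SatisfiesUSC (Ideal.span
      ({MvPolynomial.X 0 ^ 2 + MvPolynomial.X 1 ^ 2 - 1} : Set (MvPolynomial (Fin 2) ℝ))) := by
  intro H
  set h : MvPolynomial (Fin 2) ℝ := MvPolynomial.X 0 ^ 2 + MvPolynomial.X 1 ^ 2 - 1 with hh
  obtain ⟨b, hb, hu⟩ := H 1 ![MvPolynomial.X 0, MvPolynomial.X 1, h] (by
    rw [Ideal.eq_top_iff_one]
    have e : (1 : MvPolynomial (Fin 2) ℝ) = MvPolynomial.X 0 * MvPolynomial.X 0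
        + MvPolynomial.X 1 * MvPolynomial.X 1 - h := by rw [hh]; ring
    rw [e]
    refine Ideal.sub_mem _ (Ideal.add_mem _ (Ideal.mul_mem_left _ _ ?_)
      (Ideal.mul_mem_left _ _ ?_)) ?_
    · exact Ideal.subset_span ⟨0, rfl⟩
    · exact Ideal.subset_span ⟨1, rfl⟩
    · exact Ideal.subset_span ⟨2, rfl⟩)
  have key : ∀ t, Real.sin t = 0 → circEval t b = 0 := by
    intro t ht
    have hle : Ideal.span (Set.range fun i : Fin (1 + 1) =>
        (![MvPolynomial.X 0, MvPolynomial.X 1, h] : Fin 3 → MvPolynomial (Fin 2) ℝ) i.succ)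
        ≤ RingHom.ker (circEval t) := by
      rw [Ideal.span_le]
      rintro _ ⟨i, rfl⟩
      fin_cases i
      · simp [RingHom.mem_ker, circEval, ht]
      · exact circEval_rel t
    exact hle hb
  obtain ⟨t, -, ht⟩ : ∃ t ∈ Set.Icc 0 Real.pi, circEval t (MvPolynomial.X 0 + b) = 0 := by
    refine intermediate_value_Icc' Real.pi_pos.le (circEval_cont _).continuousOn ⟨?_, ?_⟩
    · simp only [map_add, key Real.pi Real.sin_pi]; simp [circEval]
    · simp only [map_add, key 0 Real.sin_zero]; simp [circEval]
  have hu2 := hu.map (Ideal.Quotient.lift (Ideal.span {h}) (circEval t) (by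
    intro a ha
    have hle : Ideal.span {h} ≤ RingHom.ker (circEval t) := by
      rw [Ideal.span_le]
      rintro _ rfl
      exact circEval_rel t
    exact hle ha))
  exact hu2.ne_zero ht
end

section
/- The ideal ⟨x² + y² + z² − 1⟩ of the polynomial ring ℝ[x,y,z] in three variables over the real numbers does not satisfy the USC. -/
open Matrix

theorem stmt17 :
    ¬ SatisfiesUSC (Ideal.span
      ({MvPolynomial.X 0 ^ 2 + MvPolynomial.X 1 ^ 2 + MvPolynomial.X 2 ^ 2 - 1} :
        Set (MvPolynomial (Fin 3) ℝ))) := by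
  intro h
  obtain ⟨b, hb, hu⟩ := h 0
    ![MvPolynomial.X 2, 1 - MvPolynomial.X 2 ^ 2] (by
      rw [Ideal.eq_top_iff_one]
      have h0 := Ideal.subset_span (Set.mem_range_self
        (f := (![MvPolynomial.X 2, 1 - MvPolynomial.X 2 ^ 2] :
          Fin 2 → MvPolynomial (Fin 3) ℝ)) 0)
      have h1 := Ideal.subset_span (Set.mem_range_self
        (f := (![MvPolynomial.X 2, 1 - MvPolynomial.X 2 ^ 2] :
          Fin 2 → MvPolynomial (Fin 3) ℝ)) 1)
      have h2 := Ideal.add_mem _ (Ideal.mul_mem_left _ (MvPolynomial.X 2) h0) h1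
      convert h2 using 1
      simp
      ring)
  have hb' : b ∈ Ideal.span {(1 - MvPolynomial.X 2 ^ 2 : MvPolynomial (Fin 3) ℝ)} := by
    refine Ideal.span_mono ?_ hb
    rintro _ ⟨i, rfl⟩
    fin_cases i
    simp
  obtain ⟨r, rfl⟩ := Ideal.mem_span_singleton'.1 hb'
  obtain ⟨v, hv⟩ := hu.exists_right_inv
  obtain ⟨q, rfl⟩ := Ideal.Quotient.mk_surjective v
  rw [← map_mul, ← map_one (Ideal.Quotient.mk _), Ideal.Quotient.eq,
    Ideal.mem_span_singleton'] at hv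
  obtain ⟨g, hg⟩ := hv
  let p : ℝ → Fin 3 → ℝ := fun t => ![Real.sin t, 0, Real.cos t]
  let F : ℝ → ℝ := fun t => Real.cos t + MvPolynomial.eval (p t) r * (1 - Real.cos t ^ 2)
  have hp : Continuous p := by
    refine continuous_pi fun i => ?_
    fin_cases i <;> simp [p] <;> fun_prop
  have hF : Continuous F := by
    have : Continuous fun t => MvPolynomial.eval (p t) r :=
      (MvPolynomial.continuous_eval r).comp hp
    fun_prop
  obtain ⟨t, -, ht⟩ := intermediate_value_Icc' Real.pi_pos.le hF.continuousOn
    (show (0 : ℝ) ∈ Set.Icc (F Real.pi) (F 0) by simp [F])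
  have := congrArg (MvPolynomial.eval (p t)) hg
  simp [p] at this
  simp only [F, p] at ht
  rw [ht] at this
  simp at this
end

section
/- Let K be a field and let S = ∏_{i ∈ ℕ} K_i be the infinite direct product of rings with K_i = K for all i ∈ ℕ. Then the zero ideal of S satisfies the USC, and the zero ideal is contained in infinitely many maximal ideals of S. -/
open Matrix

theorem stmt18 (K : Type*) [Field K] :
    SatisfiesUSC (⊥ : Ideal (ℕ → K)) ∧
    {M : Ideal (ℕ → K) | M.IsMaximal ∧ (⊥ : Ideal (ℕ → K)) ≤ M}.Infinite := by
  constructor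
  · intro k a ha
    have h1 : (1 : ℕ → K) ∈ Ideal.span (Set.range a) := by rw [ha]; trivial
    obtain ⟨c, hc⟩ := Ideal.mem_span_range_iff_exists_fun.1 h1
    rw [Fin.sum_univ_succ] at hc
    classical
    set d : ℕ → K := ∑ i : Fin (k + 1), c i.succ * a i.succ with hd
    refine ⟨(fun n => if a 0 n = 0 then 1 else 0) * d, Ideal.mul_mem_left _ _ ?_, ?_⟩
    · rw [hd]
      exact Ideal.sum_mem _ fun i _ =>
        Ideal.mul_mem_left _ _ (Ideal.subset_span ⟨i, rfl⟩)
    · apply IsUnit.map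
      rw [Pi.isUnit_iff]
      intro n
      rw [isUnit_iff_ne_zero]
      have hn := congrFun hc n
      simp only [Pi.add_apply, Pi.mul_apply, Pi.one_apply] at hn ⊢
      by_cases h : a 0 n = 0
      · rw [h, mul_zero, zero_add] at hn
        simp [h, hn]
      · simp [h]
  · refine Set.infinite_of_injective_forall_mem
      (f := fun n : ℕ => RingHom.ker (Pi.evalRingHom (fun _ : ℕ => K) n)) ?_ ?_
    · intro m n hmn
      by_contra hne
      have h : (Pi.single m 1 : ℕ → K) ∈ RingHom.ker (Pi.evalRingHom (fun _ : ℕ => K) n) := by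
        simp [RingHom.mem_ker, Pi.single_apply, Ne.symm hne]
      have h2 : (Pi.single m 1 : ℕ → K) ∈ RingHom.ker (Pi.evalRingHom (fun _ : ℕ => K) m) := by
        have hmn' : RingHom.ker (Pi.evalRingHom (fun _ : ℕ => K) m)
          = RingHom.ker (Pi.evalRingHom (fun _ : ℕ => K) n) := hmn
        rw [hmn']; exact h
      simp [RingHom.mem_ker] at h2
    · intro n
      exact ⟨RingHom.ker_isMaximal_of_surjective _ (Function.surjective_eval n), bot_le⟩
end

section
/- Let (O_i)_{i ∈ ℕ} be a countable family of Dedekind domains and for each i ∈ ℕ let J_i ⊊ O_i be a nonzero proper ideal. Let S = ∏_{i ∈ ℕ} O_i be the product ring and J = ∏_{i ∈ ℕ} J_i the ideal of S consisting of all sequences whose i-th entry lies in J_i for every i. Then the quotient ring S/J is isomorphic to ∏_{i ∈ ℕ} O_i/J_i, the ideal J is contained in infinitely many maximal ideals of S, and J satisfies the USC in S. -/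
open Matrix

/-- The product ideal `∏ᵢ Jᵢ` inside the product ring `∏ᵢ Oᵢ`, consisting of all
sequences whose `i`-th entry lies in `Jᵢ` for every `i`. -/
def piIdeal {O : ℕ → Type*} [∀ i, CommRing (O i)] (J : ∀ i, Ideal (O i)) :
    Ideal (∀ i, O i) where
  carrier := {f | ∀ i, f i ∈ J i}
  add_mem' ha hb i := (J i).add_mem (ha i) (hb i)
  zero_mem' i := (J i).zero_mem
  smul_mem' c f hf i := Ideal.mul_mem_left _ (c i) (hf i)

theorem local_usc {R : Type*} [CommRing R] [IsDomain R] [IsDedekindDomain R] (J : Ideal R)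
    (hJ : J ≠ ⊥) (c a t : R) (h : c * a + t = 1) :
    ∃ r y : R, (a + r * t) * y - 1 ∈ J := by
  classical
  have hfin := Ideal.finite_factors hJ
  have hr : ∃ r : R, ∀ v : IsDedekindDomain.HeightOneSpectrum R, v ∈ hfin.toFinset →
      r - (if a ∈ v.asIdeal then 1 else 0) ∈ v.asIdeal := by
    obtain ⟨r, hr⟩ := IsDedekindDomain.exists_forall_sub_mem_ideal (s := hfin.toFinset)
      (fun v : IsDedekindDomain.HeightOneSpectrum R => v.asIdeal) (fun _ => 1)
      (fun v _ => v.prime)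
      (fun v _ w _ hvw e => hvw (IsDedekindDomain.HeightOneSpectrum.ext e))
      (fun v => if a ∈ v.1.asIdeal then 1 else 0)
    exact ⟨r, fun v hv => by simpa using hr v hv⟩
  obtain ⟨r, hr⟩ := hr
  have key : Ideal.span {a + r * t} ⊔ J = ⊤ := by
    by_contra hne
    obtain ⟨m, hm, hle⟩ := Ideal.exists_le_maximal _ hne
    have hJm : J ≤ m := le_sup_right.trans hle
    have ham : a + r * t ∈ m := hle (Ideal.mem_sup_left (Ideal.mem_span_singleton_self _))
    have hmb : m ≠ ⊥ := fun e => hJ (le_bot_iff.mp (e ▸ hJm))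
    have hv := hr ⟨m, hm.isPrime, hmb⟩ (by
      simpa using Ideal.dvd_iff_le.mpr hJm)
    have h1 : (1 : R) ∉ m := fun e => hm.ne_top ((Ideal.eq_top_iff_one _).mpr e)
    simp only at hv
    split_ifs at hv with ha
    · apply h1
      have : (1 : R) = c * a + ((a + r * t) - a - (r - 1) * t) := by linear_combination -h
      rw [this]
      exact m.add_mem (m.mul_mem_left _ ha) (m.sub_mem (m.sub_mem ham ha) (m.mul_mem_right _ hv))
    · apply ha
      have : a = (a + r * t) - (r - 0) * t := by ring
      rw [this]
      exact m.sub_mem ham (m.mul_mem_right _ hv)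
  have h1 : (1 : R) ∈ Ideal.span {a + r * t} ⊔ J := key ▸ Submodule.mem_top
  obtain ⟨x, hx, z, hz, hxz⟩ := Submodule.mem_sup.mp h1
  obtain ⟨y, rfl⟩ := Ideal.mem_span_singleton'.mp hx
  refine ⟨r, y, ?_⟩
  have : (a + r * t) * y - 1 = -z := by linear_combination hxz
  rw [this]
  exact J.neg_mem hz

theorem stmt19 (O : ℕ → Type*) [∀ i, CommRing (O i)] [∀ i, IsDomain (O i)]
    [∀ i, IsDedekindDomain (O i)] (J : ∀ i, Ideal (O i))
    (hbot : ∀ i, J i ≠ ⊥) (htop : ∀ i, J i ≠ ⊤) :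
    Nonempty (((∀ i, O i) ⧸ piIdeal J) ≃+* ∀ i, O i ⧸ J i) ∧
    {M : Ideal (∀ i, O i) | M.IsMaximal ∧ piIdeal J ≤ M}.Infinite ∧
    SatisfiesUSC (piIdeal J) := by
  refine ⟨?_, ?_, ?_⟩
  · let f : (∀ i, O i) →+* ∀ i, O i ⧸ J i :=
      Pi.ringHom fun i => (Ideal.Quotient.mk (J i)).comp (Pi.evalRingHom O i)
    have hk : RingHom.ker f = piIdeal J := by
      ext x
      rw [RingHom.mem_ker]
      constructor
      · intro h i
        exact Ideal.Quotient.eq_zero_iff_mem.mp (congrFun h i)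
      · intro h
        funext i
        exact Ideal.Quotient.eq_zero_iff_mem.mpr (h i)
    have hs : Function.Surjective f := by
      intro y
      choose x hx using fun i => Ideal.Quotient.mk_surjective (y i)
      exact ⟨x, funext hx⟩
    exact ⟨(Ideal.quotEquivOfEq hk.symm).trans (RingHom.quotientKerEquivOfSurjective hs)⟩
  · choose M hM hJM using fun i => Ideal.exists_le_maximal (J i) (htop i)
    refine Set.infinite_of_injective_forall_mem
      (f := fun i : ℕ => (M i).comap (Pi.evalRingHom O i)) ?_ ?_
    · intro i j hij
      by_contra hne
      have h1 : (Pi.single i 1 : ∀ i, O i) ∈ (M j).comap (Pi.evalRingHom O j) := by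
        simp [Ideal.mem_comap, Pi.single_eq_of_ne (Ne.symm hne)]
      have hij' : (M i).comap (Pi.evalRingHom O i) = (M j).comap (Pi.evalRingHom O j) := hij
      rw [← hij', Ideal.mem_comap] at h1
      simp only [Pi.evalRingHom_apply, Pi.single_eq_same] at h1
      exact (hM i).ne_top ((Ideal.eq_top_iff_one _).mpr h1)
    · intro i
      haveI := hM i
      exact ⟨Ideal.comap_isMaximal_of_surjective _ (Function.surjective_eval i),
        fun x hx => hJM i (hx i)⟩
  · intro k a ha
    have h1 : (1 : ∀ i, O i) ∈ Ideal.span (Set.range a) := ha ▸ Submodule.mem_top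
    obtain ⟨c, hc⟩ := (Ideal.mem_span_range_iff_exists_fun).mp h1
    rw [Fin.sum_univ_succ] at hc
    set t : ∀ i, O i := ∑ i : Fin (k + 1), c i.succ * a i.succ with ht
    have htm : t ∈ Ideal.span (Set.range fun i : Fin (k + 1) => a i.succ) :=
      Ideal.sum_mem _ fun i _ => Ideal.mul_mem_left _ _ (Ideal.subset_span ⟨i, rfl⟩)
    choose r y hry using fun i => local_usc (J i) (hbot i) (c 0 i) (a 0 i) (t i) (congrFun hc i)
    refine ⟨r * t, Ideal.mul_mem_left _ _ htm, ?_⟩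
    refine IsUnit.of_mul_eq_one (Ideal.Quotient.mk _ y) ?_
    rw [← map_mul, ← map_one (Ideal.Quotient.mk (piIdeal J)), Ideal.Quotient.eq]
    exact hry
end
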